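/- arXiv:2203.12383 — 3 statements merged into one kernel-verified Lean document; each statement's English description precedes it below -/
import Mathlib

section
/- Let u ≢ -∞ be subharmonic on ℂ with Riesz mass distribution Δ_u := (1/(2π))Δu, let z ∈ ℂ be a point with u(z) > -∞, and let ρ > 0. Then the circular mean (1/(2π)) ∫₀^{2π} u(z + ρe^{iθ}) dθ equals u(z) + ∫₀^ρ ν_z(t)/t dt, where ν_z(t) := Δ_u(D̄(z, t)). -/
open MeasureTheory Metric Set Real

/-- An `EReal`-valued function on `ℂ` is subharmonic if it is upper semicontinuous,
never takes the value `+∞`, and satisfies the sub-mean-value inequality over every circle,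
expressed via the truncations `max (u ·) (-n)` (which are real-valued). -/
def SubharmonicFn (u : ℂ → EReal) : Prop :=
  UpperSemicontinuous u ∧ (∀ z, u z < ⊤) ∧
    ∀ z : ℂ, ∀ ρ : ℝ, 0 < ρ → ∀ n : ℕ,
      u z ≤ ((2 * Real.pi)⁻¹ * ∫ θ in (0 : ℝ)..(2 * Real.pi),
        (max (u (z + ρ * Complex.exp (θ * Complex.I))) ((-(n : ℝ) : ℝ) : EReal)).toReal : ℝ)

/-- The Laplacian of a real-valued function on `ℂ ≃ ℝ²`. -/
noncomputable def lap (φ : ℂ → ℝ) (z : ℂ) : ℝ :=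
  iteratedFDeriv ℝ 2 φ z ![1, 1] + iteratedFDeriv ℝ 2 φ z ![Complex.I, Complex.I]

/-- `μ` is the Riesz mass distribution `(1/(2π))Δu` of `u` in the sense of distributions. -/
def IsRieszMeasure (u : ℂ → EReal) (μ : Measure ℂ) : Prop :=
  ∀ φ : ℂ → ℝ, ContDiff ℝ 2 φ → HasCompactSupport φ →
    ∫ z : ℂ, (u z).toReal * lap φ z = (2 * Real.pi) * ∫ z : ℂ, φ z ∂μ

open Filter Topology

/-- angular measure -/
noncomputable abbrev TT : Measure ℝ := volume.restrict (Ioo (-π) π)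

noncomputable def Wf (u : ℂ → EReal) (C : ℝ) (w : ℂ) : ENNReal := ((C : EReal) - u w).toENNReal

lemma antitone_aux (C : ℝ) : Antitone (fun x : EReal => ((C : EReal) - x).toENNReal) := by
  intro a b hab
  exact EReal.toENNReal_le_toENNReal (EReal.sub_le_sub le_rfl hab)

lemma continuous_aux (C : ℝ) : Continuous (fun x : EReal => ((C : EReal) - x).toENNReal) := by
  apply Continuous.ereal_toENNReal
  rw [continuous_iff_continuousAt]
  intro x
  have h := EReal.continuousAt_add (p := ((C : EReal), -x)) (Or.inl (by simp)) (Or.inl (by simp))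
  have h2 : ContinuousAt (fun x : EReal => ((C : EReal), -x)) x := by fun_prop
  exact ContinuousAt.comp (f := fun x : EReal => ((C : EReal), -x)) h h2

lemma Wf_lsc {u : ℂ → EReal} (hu : SubharmonicFn u) (C : ℝ) : LowerSemicontinuous (Wf u C) :=
  (continuous_aux C).comp_upperSemicontinuous_antitone hu.1 (antitone_aux C)

lemma Wf_meas {u : ℂ → EReal} (hu : SubharmonicFn u) (C : ℝ) : Measurable (Wf u C) :=
  (Wf_lsc hu C).measurable

lemma u_meas {u : ℂ → EReal} (hu : SubharmonicFn u) : Measurable u := hu.1.measurable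

lemma Wf_bot {u : ℂ → EReal} {C : ℝ} {w : ℂ} (h : u w = ⊥) : Wf u C w = ⊤ := by
  simp [Wf, h]

lemma Wf_real {u : ℂ → EReal} (hu : SubharmonicFn u) {C : ℝ} {w : ℂ} (h : u w ≠ ⊥) :
    Wf u C w = ENNReal.ofReal (C - (u w).toReal) := by
  have := EReal.coe_toReal (hu.2.1 w).ne h
  conv_lhs => rw [Wf, ← this, ← EReal.coe_sub, EReal.toENNReal_of_ne_top (EReal.coe_ne_top _), EReal.toReal_coe]

lemma per_int (f : ℂ → ℝ) (z : ℂ) (r : ℝ) :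
    ∫ θ in (0 : ℝ)..(2 * π), f (circleMap z r θ) = ∫ θ, f (circleMap z r θ) ∂TT := by
  have hp : Function.Periodic (fun θ => f (circleMap z r θ)) (2 * π) := fun θ => by
    simp [periodic_circleMap z r θ]
  have := hp.intervalIntegral_add_eq 0 (-π)
  rw [zero_add] at this
  rw [this, show -π + 2 * π = π by ring,
    intervalIntegral.integral_of_le (by linarith [pi_pos]), integral_Ioc_eq_integral_Ioo]

lemma TT_univ : TT univ = ENNReal.ofReal (2 * π) := by
  rw [Measure.restrict_apply_univ, Real.volume_Ioo]; ring_nf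

lemma TT_real_univ : TT.real univ = 2 * π := by
  rw [Measure.real, TT_univ, ENNReal.toReal_ofReal (by positivity)]

lemma W_super {u : ℂ → EReal} (hu : SubharmonicFn u) {C : ℝ} {w : ℂ} {s : ℝ} (hs : 0 < s)
    (hC : ∀ α, u (circleMap w s α) ≤ C) :
    ∫⁻ α, Wf u C (circleMap w s α) ∂TT ≤ ENNReal.ofReal (2 * π) * Wf u C w := by
  by_cases hw : u w = ⊥
  · rw [Wf_bot hw, ENNReal.mul_top (by simp [pi_pos])]; exact le_top
  rw [Wf_real hu hw, ← ENNReal.ofReal_mul (by positivity)]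
  set m : ℕ → ℝ → ℝ := fun n α => (max (u (circleMap w s α)) ((-(n : ℝ) : ℝ) : EReal)).toReal with hm
  have hum : Measurable (fun α => u (circleMap w s α)) :=
    (u_meas hu).comp (continuous_circleMap w s).measurable
  have hmm : ∀ n, Measurable (m n) := fun n => (hum.max measurable_const).ereal_toReal
  have hcoe : ∀ n α, ((m n α : ℝ) : EReal) = max (u (circleMap w s α)) ((-(n : ℝ) : ℝ) : EReal) := by
    intro n α
    apply EReal.coe_toReal
    · exact (max_lt (hu.2.1 _) (EReal.coe_lt_top _)).ne
    · exact ((EReal.bot_lt_coe _).trans_le (le_max_right _ _)).ne'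
  have hm_ge : ∀ (n : ℕ) α, -(n : ℝ) ≤ m n α := by
    intro n α
    rw [← EReal.coe_le_coe_iff, hcoe]; exact le_max_right _ _
  have hm_le : ∀ (n : ℕ) α, -(n : ℝ) ≤ C → m n α ≤ C := by
    intro n α h
    rw [← EReal.coe_le_coe_iff, hcoe]; exact max_le (hC α) (by exact_mod_cast h)
  have key : ∀ n : ℕ, -(n : ℝ) ≤ C →
      ∫⁻ α, ENNReal.ofReal (C - m n α) ∂TT ≤ ENNReal.ofReal (2 * π * (C - (u w).toReal)) := by
    intro n hn
    have hint : Integrable (m n) TT := by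
      refine Integrable.of_bound (hmm n).aestronglyMeasurable (max |C| n) (Eventually.of_forall ?_)
      intro α
      rw [Real.norm_eq_abs, abs_le]
      constructor
      · have := hm_ge n α
        have := le_max_right |C| (n : ℝ)
        linarith
      · exact (hm_le n α hn).trans ((le_abs_self C).trans (le_max_left _ _))
    have hint2 : Integrable (fun α => C - m n α) TT := (integrable_const C).sub hint
    rw [← ofReal_integral_eq_lintegral_ofReal hint2
      (Eventually.of_forall fun α => by simpa using hm_le n α hn)]
    apply ENNReal.ofReal_le_ofReal
    rw [integral_sub (integrable_const C) hint, integral_const, TT_real_univ]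
    have h3 := hu.2.2 w s hs n
    rw [← EReal.coe_toReal (hu.2.1 w).ne hw, EReal.coe_le_coe_iff] at h3
    have h4 := per_int (fun p => (max (u p) ((-(n : ℝ) : ℝ) : EReal)).toReal) w s
    simp only [circleMap] at h4
    rw [h4] at h3
    have h5 : (2 * π) * (u w).toReal ≤ ∫ α, m n α ∂TT := by
      rw [inv_mul_eq_div, le_div_iff₀ (by positivity)] at h3
      rw [mul_comm]; exact h3
    rw [smul_eq_mul]; linarith
  have hW : ∀ α n, ENNReal.ofReal (C - m n α) =
      ((C : EReal) - max (u (circleMap w s α)) ((-(n : ℝ) : ℝ) : EReal)).toENNReal := by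
    intro α n
    rw [← hcoe, ← EReal.coe_sub, EReal.toENNReal_of_ne_top (EReal.coe_ne_top _), EReal.toReal_coe]
  have ht : Tendsto (fun n : ℕ => ∫⁻ α, ENNReal.ofReal (C - m n α) ∂TT) atTop
      (𝓝 (∫⁻ α, Wf u C (circleMap w s α) ∂TT)) := by
    apply lintegral_tendsto_of_tendsto_of_monotone
    · intro n; exact (measurable_const.sub (hmm n)).ennreal_ofReal.aemeasurable
    · refine Eventually.of_forall fun α => ?_
      intro a b hab
      simp only [hW]
      apply antitone_aux
      apply max_le_max le_rfl
      have : (a : ℝ) ≤ b := by exact_mod_cast hab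
      exact_mod_cast neg_le_neg this
    · refine Eventually.of_forall fun α => ?_
      simp only [hW, Wf]
      apply ((continuous_aux C).tendsto _).comp
      have h1 : Tendsto (fun n : ℕ => ((-(n : ℝ) : ℝ) : EReal)) atTop (𝓝 ⊥) := by
        rw [EReal.tendsto_nhds_bot_iff_real]
        intro x
        obtain ⟨N, hN⟩ := exists_nat_gt (-x)
        filter_upwards [eventually_ge_atTop N] with n hn
        rw [EReal.coe_lt_coe_iff]
        have : (N : ℝ) ≤ n := by exact_mod_cast hn
        linarith
      have := (tendsto_const_nhds (x := u (circleMap w s α))).max h1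
      simpa using this
  refine le_of_tendsto ht ?_
  obtain ⟨N, hN⟩ := exists_nat_gt (-C)
  filter_upwards [eventually_ge_atTop N] with n hn
  apply key
  have : (N : ℝ) ≤ n := by exact_mod_cast hn
  linarith

noncomputable def Mf (u : ℂ → EReal) (z : ℂ) (r : ℝ) : ℝ := ∫ θ, (u (circleMap z r θ)).toReal ∂TT

lemma exists_C {u : ℂ → EReal} (hu : SubharmonicFn u) (z : ℂ) (R : ℝ) :
    ∃ C : ℝ, 0 ≤ C ∧ ∀ w ∈ closedBall z R, u w ≤ C := by
  by_cases hR : (closedBall z R).Nonempty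
  · obtain ⟨a, ha, ham⟩ := UpperSemicontinuousOn.exists_isMaxOn hR (isCompact_closedBall z R)
      (hu.1.upperSemicontinuousOn _)
    refine ⟨max 0 (u a).toReal, le_max_left _ _, fun w hw => (ham hw).trans ?_⟩
    refine (EReal.le_coe_toReal (hu.2.1 a).ne).trans ?_
    exact_mod_cast le_max_right _ _
  · exact ⟨0, le_rfl, fun w hw => (hR ⟨w, hw⟩).elim⟩

lemma circle_mem (z : ℂ) {r R : ℝ} (hr : 0 ≤ r) (hrR : r ≤ R) (θ : ℝ) :
    circleMap z r θ ∈ closedBall z R :=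
  closedBall_subset_closedBall hrR (circleMap_mem_closedBall z hr θ)

lemma u_circ_meas {u : ℂ → EReal} (hu : SubharmonicFn u) (z : ℂ) (r : ℝ) :
    Measurable fun θ => u (circleMap z r θ) :=
  (u_meas hu).comp (continuous_circleMap z r).measurable

lemma W_circ_meas {u : ℂ → EReal} (hu : SubharmonicFn u) (C : ℝ) (z : ℂ) (r : ℝ) :
    Measurable fun θ => Wf u C (circleMap z r θ) :=
  (Wf_meas hu C).comp (continuous_circleMap z r).measurable

lemma toReal_le_of {x : EReal} {C : ℝ} (hC : 0 ≤ C) (h : x ≤ C) : x.toReal ≤ C := by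
  by_cases hx : x = ⊥
  · simpa [hx] using hC
  · exact EReal.toReal_le_toReal h hx (by simp)

lemma W_center {u : ℂ → EReal} (hu : SubharmonicFn u) {C : ℝ} {z : ℂ} {r R : ℝ} (hr : 0 ≤ r)
    (hrR : r ≤ R) (hC : ∀ w ∈ closedBall z R, u w ≤ C) :
    ∫⁻ α, Wf u C (circleMap z r α) ∂TT ≤ ENNReal.ofReal (2 * π) * Wf u C z := by
  rcases hr.eq_or_lt with rfl | h
  · simp only [circleMap_zero_radius, Function.const_apply, lintegral_const, TT_univ]
    rw [mul_comm]
  · exact W_super hu h fun α => hC _ (circle_mem z hr hrR α)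

lemma circ_basic {u : ℂ → EReal} (hu : SubharmonicFn u) {C : ℝ} (hC0 : 0 ≤ C) {z : ℂ} {R : ℝ}
    (hC : ∀ w ∈ closedBall z R, u w ≤ C) (hz : u z ≠ ⊥) {r : ℝ} (hr : 0 ≤ r) (hrR : r ≤ R) :
    (∀ᵐ θ ∂TT, u (circleMap z r θ) ≠ ⊥) ∧
    Integrable (fun θ => (u (circleMap z r θ)).toReal) TT ∧
    ∫⁻ θ, Wf u C (circleMap z r θ) ∂TT = ENNReal.ofReal (2 * π * C - Mf u z r) ∧
    Mf u z r ≤ 2 * π * C ∧ 2 * π * (u z).toReal ≤ Mf u z r := by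
  have hle := W_center hu hr hrR hC
  have hfin : ∫⁻ α, Wf u C (circleMap z r α) ∂TT ≠ ⊤ := by
    refine (hle.trans_lt ?_).ne
    rw [Wf_real hu hz]
    exact ENNReal.mul_lt_top ENNReal.ofReal_lt_top ENNReal.ofReal_lt_top
  have h1 : ∀ᵐ θ ∂TT, u (circleMap z r θ) ≠ ⊥ := by
    filter_upwards [ae_lt_top (W_circ_meas hu C z r) hfin] with θ hθ hb
    rw [Wf_bot hb] at hθ
    exact lt_irrefl _ hθ
  have hvle : ∀ θ, (u (circleMap z r θ)).toReal ≤ C := fun θ =>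
    toReal_le_of hC0 (hC _ (circle_mem z hr hrR θ))
  have heq : ∫⁻ θ, Wf u C (circleMap z r θ) ∂TT
      = ∫⁻ θ, ENNReal.ofReal (C - (u (circleMap z r θ)).toReal) ∂TT := by
    apply lintegral_congr_ae
    filter_upwards [h1] with θ hθ using Wf_real hu hθ
  have hmeas : Measurable fun θ => (u (circleMap z r θ)).toReal := (u_circ_meas hu z r).ereal_toReal
  have hint' : Integrable (fun θ => C - (u (circleMap z r θ)).toReal) TT := by
    refine ⟨(measurable_const.sub hmeas).aestronglyMeasurable, ?_⟩
    rw [hasFiniteIntegral_iff_ofReal (Eventually.of_forall fun θ => by simpa using hvle θ), ← heq]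
    exact hfin.lt_top
  have hint : Integrable (fun θ => (u (circleMap z r θ)).toReal) TT := by
    have := (integrable_const (μ := TT) C).sub hint'
    refine this.congr (Eventually.of_forall fun θ => by simp)
  have hI : ∫ θ, (C - (u (circleMap z r θ)).toReal) ∂TT = 2 * π * C - Mf u z r := by
    rw [integral_sub (integrable_const C) hint, integral_const, TT_real_univ, smul_eq_mul, Mf]
  have h3 : ∫⁻ θ, Wf u C (circleMap z r θ) ∂TT = ENNReal.ofReal (2 * π * C - Mf u z r) := by
    rw [heq, ← ofReal_integral_eq_lintegral_ofReal hint'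
      (Eventually.of_forall fun θ => by simpa using hvle θ), hI]
  have h4 : Mf u z r ≤ 2 * π * C := by
    have : 0 ≤ ∫ θ, (C - (u (circleMap z r θ)).toReal) ∂TT :=
      integral_nonneg fun θ => by simpa using hvle θ
    linarith
  refine ⟨h1, hint, h3, h4, ?_⟩
  rw [h3, Wf_real hu hz, ← ENNReal.ofReal_mul (by positivity)] at hle
  have hzC : (u z).toReal ≤ C := toReal_le_of hC0 (hC z (mem_closedBall_self (hr.trans hrR)))
  rw [ENNReal.ofReal_le_ofReal_iff (mul_nonneg (by positivity) (by linarith))] at hle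
  linarith

lemma abs_bound {u : ℂ → EReal} (hu : SubharmonicFn u) {C : ℝ} (hC0 : 0 ≤ C) {z : ℂ} {R : ℝ}
    (hC : ∀ w ∈ closedBall z R, u w ≤ C) (hz : u z ≠ ⊥) {r : ℝ} (hr : 0 ≤ r) (hrR : r ≤ R) :
    ∫ θ, |(u (circleMap z r θ)).toReal| ∂TT ≤ 2 * π * (2 * C - (u z).toReal) := by
  obtain ⟨_, h2, _, _, h5⟩ := circ_basic hu hC0 hC hz hr hrR
  have : ∫ θ, |(u (circleMap z r θ)).toReal| ∂TT ≤
      ∫ θ, (2 * C - (u (circleMap z r θ)).toReal) ∂TT := by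
    apply integral_mono h2.abs ((integrable_const _).sub h2)
    intro θ
    have := toReal_le_of hC0 (hC _ (circle_mem z hr hrR θ))
    simp only [Pi.sub_apply]
    rw [abs_le]; constructor <;> linarith
  rw [integral_sub (integrable_const _) h2, integral_const, TT_real_univ, smul_eq_mul] at this
  change _ ≤ _ - Mf u z r at this
  linarith

lemma M_usc {u : ℂ → EReal} (hu : SubharmonicFn u) {z : ℂ} (hz : u z ≠ ⊥) {ρ : ℝ} (hρ : 0 ≤ ρ)
    {r : ℕ → ℝ} (hr : ∀ n, 0 ≤ r n) (hrt : Tendsto r atTop (𝓝 ρ)) {L : ℝ}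
    (hL : Tendsto (fun n => Mf u z (r n)) atTop (𝓝 L)) : L ≤ Mf u z ρ := by
  obtain ⟨C, hC0, hC⟩ := exists_C hu z (ρ + 1)
  have hev : ∀ᶠ n in atTop, r n ≤ ρ + 1 := by
    filter_upwards [hrt.eventually (gt_mem_nhds (lt_add_one ρ))] with n hn using hn.le
  obtain ⟨_, _, h3, h4, _⟩ := circ_basic hu hC0 hC hz hρ (by linarith)
  have hLC : L ≤ 2 * π * C := le_of_tendsto hL (by
    filter_upwards [hev] with n hn using (circ_basic hu hC0 hC hz (hr n) hn).2.2.2.1)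
  have key : ∫⁻ θ, Wf u C (circleMap z ρ θ) ∂TT ≤
      liminf (fun n => ∫⁻ θ, Wf u C (circleMap z (r n) θ) ∂TT) atTop := by
    refine le_trans (lintegral_mono fun θ => ?_)
      (lintegral_liminf_le fun n => W_circ_meas hu C z (r n))
    have h := LowerSemicontinuousAt.le_liminf (Wf_lsc hu C (circleMap z ρ θ))
    refine h.trans ?_
    have ht : Tendsto (fun n => circleMap z (r n) θ) atTop (𝓝 (circleMap z ρ θ)) := by
      unfold circleMap
      exact tendsto_const_nhds.add
        (((Complex.continuous_ofReal.tendsto ρ).comp hrt).mul tendsto_const_nhds)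
    have := liminf_le_liminf_of_le (u := Wf u C) ht
    exact this
  have hlim : Tendsto (fun n => ∫⁻ θ, Wf u C (circleMap z (r n) θ) ∂TT) atTop
      (𝓝 (ENNReal.ofReal (2 * π * C - L))) := by
    have : Tendsto (fun n => ENNReal.ofReal (2 * π * C - Mf u z (r n))) atTop
      (𝓝 (ENNReal.ofReal (2 * π * C - L))) :=
      (ENNReal.continuous_ofReal.tendsto _).comp (tendsto_const_nhds.sub hL)
    refine this.congr' ?_
    filter_upwards [hev] with n hn using (circ_basic hu hC0 hC hz (hr n) hn).2.2.1.symm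
  rw [hlim.liminf_eq, h3, ENNReal.ofReal_le_ofReal_iff (by linarith)] at key
  linarith

lemma shift_lint (f : ℂ → ENNReal) (z : ℂ) (r φ : ℝ) :
    ∫⁻ θ, f (circleMap z r (θ + φ)) ∂TT = ∫⁻ θ, f (circleMap z r θ) ∂TT := by
  have hp : Function.Periodic (fun θ => f (circleMap z r θ)) (2 * π) := fun θ => by
    simp [periodic_circleMap z r θ]
  have h2 : (0 : ℝ) < 2 * π := by positivity
  have : VAddInvariantMeasure (AddSubgroup.zmultiples (2 * π)) ℝ volume :=
    ⟨fun c s _ => measure_preimage_add _ _ _⟩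
  have e1 : ∫⁻ θ in Ioc (-π + φ) (-π + φ + 2 * π), f (circleMap z r θ)
      = ∫⁻ θ in Ioc (-π) (-π + 2 * π), f (circleMap z r θ) := by
    refine (isAddFundamentalDomain_Ioc h2 (-π + φ) volume).setLIntegral_eq
      (isAddFundamentalDomain_Ioc h2 (-π) volume) (fun θ => f (circleMap z r θ)) ?_
    exact hp.map_vadd_zmultiples
  have e2 : ∫⁻ θ in Ioc (-π + φ) (-π + φ + 2 * π), f (circleMap z r θ)
     = ∫⁻ θ in Ioc (-π) π, f (circleMap z r (θ + φ)) := by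
    have := (measurePreserving_add_right volume φ).setLIntegral_comp_preimage_emb
      (measurableEmbedding_addRight φ) (fun θ => f (circleMap z r θ)) (Ioc (-π + φ) (-π + φ + 2 * π))
    rw [← this]
    congr 2
    ext x; simp only [Set.mem_preimage, Set.mem_Ioc]
    constructor <;> rintro ⟨h, h'⟩ <;> constructor <;> linarith
  rw [e2, show -π + 2 * π = π by ring] at e1
  rw [TT, setLIntegral_congr Ioo_ae_eq_Ioc, e1, ← setLIntegral_congr Ioo_ae_eq_Ioc]

lemma M_le {u : ℂ → EReal} (hu : SubharmonicFn u) {z : ℂ} (hz : u z ≠ ⊥) {ρ s : ℝ} (hρ : 0 ≤ ρ)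
    (hs : 0 < s) {A : ℝ} (hA : ∀ᵐ α ∂TT, Mf u z ‖circleMap ρ s α‖ ≤ A) : Mf u z ρ ≤ A := by
  obtain ⟨C, hC0, hC⟩ := exists_C hu z (ρ + s)
  obtain ⟨_, _, h3, h4, _⟩ := circ_basic hu hC0 hC hz hρ (by linarith)
  have hn : ∀ α, ‖circleMap (ρ : ℂ) s α‖ ≤ ρ + s := fun α => by
    unfold circleMap
    refine (norm_add_le _ _).trans ?_
    simp [Complex.norm_exp_ofReal_mul_I, abs_of_nonneg hρ, abs_of_pos hs]
  set G : ℝ → ℝ → ENNReal := fun θ α =>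
    Wf u C (z + circleMap (ρ : ℂ) s α * Complex.exp (θ * Complex.I)) with hG
  have hGm : Measurable (Function.uncurry G) := by
    refine (Wf_meas hu C).comp (Continuous.measurable ?_)
    unfold circleMap
    fun_prop
  have h5 : ∀ θ, ∫⁻ α, G θ α ∂TT ≤ ENNReal.ofReal (2 * π) * Wf u C (circleMap z ρ θ) := by
    intro θ
    refine le_trans (le_of_eq ?_) (W_super hu hs (C := C) (w := circleMap z ρ θ) ?_)
    · rw [← shift_lint (Wf u C) (circleMap z ρ θ) s θ]
      apply lintegral_congr; intro α
      simp only [hG, circleMap]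
      congr 1
      push_cast
      rw [add_mul (α : ℂ), Complex.exp_add]; ring
    · intro α
      apply hC
      rw [mem_closedBall, dist_eq_norm]
      have : circleMap (circleMap z ρ θ) s α - z = ρ * Complex.exp (θ * Complex.I)
        + s * Complex.exp (α * Complex.I) := by simp [circleMap]; ring
      rw [this]
      refine (norm_add_le _ _).trans ?_
      simp [Complex.norm_exp_ofReal_mul_I, abs_of_nonneg hρ, abs_of_pos hs]
  have h6 : ∫⁻ θ, ∫⁻ α, G θ α ∂TT ∂TT ≤
      ENNReal.ofReal (2 * π) * ENNReal.ofReal (2 * π * C - Mf u z ρ) := by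
    rw [← h3, ← lintegral_const_mul _ (W_circ_meas hu C z ρ)]
    exact lintegral_mono h5
  rw [lintegral_lintegral_swap hGm.aemeasurable] at h6
  have h7 : ∀ α, ∫⁻ θ, G θ α ∂TT = ENNReal.ofReal (2 * π * C - Mf u z ‖circleMap (ρ : ℂ) s α‖) := by
    intro α
    rw [← (circ_basic hu hC0 hC hz (norm_nonneg _) (hn α)).2.2.1,
      ← shift_lint _ _ _ (Complex.arg (circleMap (ρ : ℂ) s α))]
    apply lintegral_congr; intro θ
    simp only [hG]
    congr 1
    rw [circleMap.eq_1 z]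
    congr 1
    conv_lhs => rw [← Complex.norm_mul_exp_arg_mul_I (circleMap (ρ : ℂ) s α)]
    push_cast
    rw [add_mul (θ : ℂ), Complex.exp_add]; ring
  have h8 : ENNReal.ofReal (2 * π) * ENNReal.ofReal (2 * π * C - A) ≤
      ∫⁻ α, ∫⁻ θ, G θ α ∂TT ∂TT := by
    simp_rw [h7]
    rw [mul_comm, ← TT_univ, ← lintegral_const]
    apply lintegral_mono_ae
    filter_upwards [hA] with α hα
    apply ENNReal.ofReal_le_ofReal; linarith
  have h9 := h8.trans h6
  rw [ENNReal.mul_le_mul_iff_right (by simp [pi_pos]) ENNReal.ofReal_ne_top,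
    ENNReal.ofReal_le_ofReal_iff (by linarith)] at h9
  linarith

noncomputable def kap (γ : ℝ → ℝ) (s : ℝ) : ℝ := γ (√s) * (2 * s)⁻¹

noncomputable def kk (γ : ℝ → ℝ) (b : ℝ) (s : ℝ) : ℝ := ∫ x in (b ^ 2)..s, kap γ x

noncomputable def phi (γ : ℝ → ℝ) (b : ℝ) (z : ℂ) (w : ℂ) : ℝ := kk γ b (‖w - z‖ ^ 2)

lemma kap_smooth {γ : ℝ → ℝ} (hγ : ContDiff ℝ (⊤ : ℕ∞) γ) {a : ℝ} (ha : 0 < a)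
    (h0 : ∀ x < a, γ x = 0) : ContDiff ℝ (⊤ : ℕ∞) (kap γ) := by
  rw [contDiff_iff_contDiffAt]
  intro s
  by_cases hs : 0 < s
  · unfold kap
    refine ContDiffAt.mul ?_ ?_
    · exact hγ.contDiffAt.comp s (Real.contDiffAt_sqrt hs.ne')
    · exact ContDiffAt.inv (contDiffAt_const.mul contDiffAt_id) (by simpa using hs.ne')
  · have : kap γ =ᶠ[𝓝 s] fun _ => 0 := by
      have : s < a ^ 2 := by push Not at hs; nlinarith
      filter_upwards [gt_mem_nhds this] with x hx
      have : √x < a := by rw [Real.sqrt_lt' ha]; exact hx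
      simp [kap, h0 _ this]
    exact contDiffAt_const.congr_of_eventuallyEq this

lemma kap_sq {γ : ℝ → ℝ} {r : ℝ} (hr : 0 ≤ r) : 2 * r * kap γ (r ^ 2) = γ r / r := by
  rw [kap, Real.sqrt_sq hr]
  by_cases h : r = 0
  · simp [h]
  · field_simp

lemma kk_deriv {γ : ℝ → ℝ} (hk : ContDiff ℝ (⊤ : ℕ∞) (kap γ)) (b s : ℝ) :
    HasDerivAt (kk γ b) (kap γ s) s :=
  intervalIntegral.integral_hasDerivAt_right (hk.continuous.intervalIntegrable _ _)
    (hk.continuous.stronglyMeasurableAtFilter _ _) hk.continuous.continuousAt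

lemma kk_smooth {γ : ℝ → ℝ} (hk : ContDiff ℝ (⊤ : ℕ∞) (kap γ)) (b : ℝ) :
    ContDiff ℝ (⊤ : ℕ∞) (kk γ b) := by
  rw [contDiff_infty_iff_deriv]
  refine ⟨fun s => (kk_deriv hk b s).differentiableAt, ?_⟩
  rw [show deriv (kk γ b) = kap γ from funext fun s => (kk_deriv hk b s).deriv]
  exact hk

lemma phi_smooth {γ : ℝ → ℝ} (hk : ContDiff ℝ (⊤ : ℕ∞) (kap γ)) (b : ℝ) (z : ℂ) :
    ContDiff ℝ 2 (phi γ b z) := by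
  have h1 : ContDiff ℝ 2 (fun w : ℂ => ‖w - z‖ ^ 2) := (contDiff_id.sub contDiff_const).norm_sq ℝ
  exact ((kk_smooth hk b).of_le (WithTop.coe_le_coe.2 (le_top : (2 : ℕ∞) ≤ ⊤))).comp h1

lemma kk_eq {γ : ℝ → ℝ} (hk : ContDiff ℝ (⊤ : ℕ∞) (kap γ)) (b r : ℝ) :
    kk γ b (r ^ 2) = - ∫ t in r..b, 2 * t * kap γ (t ^ 2) := by
  have : ∫ t in r..b, 2 * t * kap γ (t ^ 2) = kk γ b (b ^ 2) - kk γ b (r ^ 2) := by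
    apply intervalIntegral.integral_eq_sub_of_hasDerivAt (f := fun t => kk γ b (t ^ 2))
    · intro t _
      have := (kk_deriv hk b (t ^ 2)).comp t (hasDerivAt_pow 2 t)
      refine this.congr_deriv ?_
      simp; ring
    · have := hk.continuous
      exact Continuous.intervalIntegrable (by fun_prop) _ _
  rw [this]; simp [kk]

lemma kk_zero {γ : ℝ → ℝ} {b s : ℝ} (hb : 0 ≤ b) (h0 : ∀ x, b < x → γ x = 0) (hs : b ^ 2 ≤ s) :
    kk γ b s = 0 := by
  unfold kk
  rw [intervalIntegral.integral_of_le hs]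
  apply setIntegral_eq_zero_of_forall_eq_zero
  intro x hx
  have : b < √x := by rw [Real.lt_sqrt hb]; exact hx.1
  simp [kap, h0 _ this]

lemma phi_compact {γ : ℝ → ℝ} {b : ℝ} (hb : 0 ≤ b) (h0 : ∀ x, b < x → γ x = 0) (z : ℂ) :
    HasCompactSupport (phi γ b z) := by
  refine HasCompactSupport.intro (isCompact_closedBall z b) fun w hw => ?_
  apply kk_zero hb h0
  rw [mem_closedBall, dist_eq_norm] at hw
  push Not at hw
  gcongr

noncomputable def JJ : ℂ →L[ℝ] ℂ →L[ℝ] ℝ := innerSL ℝ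

lemma JJ_apply (a b : ℂ) : JJ a b = inner ℝ a b := rfl

lemma phi_fderiv {γ : ℝ → ℝ} (hk : ContDiff ℝ (⊤ : ℕ∞) (kap γ)) (b : ℝ) (z : ℂ) :
    fderiv ℝ (phi γ b z) = fun w => (2 * kap γ (‖w - z‖ ^ 2)) • JJ (w - z) := by
  ext1 w
  have h1 : HasFDerivAt (fun w : ℂ => ‖w - z‖ ^ 2) (2 • JJ (w - z)) w := by
    have := ((hasFDerivAt_id (𝕜 := ℝ) w).sub_const z).norm_sq
    refine this.congr_fderiv ?_
    ext v
    simp [JJ_apply]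
  have h2 := (kk_deriv hk b (‖w - z‖ ^ 2)).comp_hasFDerivAt w h1
  refine HasFDerivAt.fderiv (h2.congr_fderiv ?_)
  ext v
  simp [JJ_apply]; ring

lemma phi_lap {γ : ℝ → ℝ} (hk : ContDiff ℝ (⊤ : ℕ∞) (kap γ)) (b : ℝ) (z w : ℂ) :
    lap (phi γ b z) w = 4 * deriv (kap γ) (‖w - z‖ ^ 2) * ‖w - z‖ ^ 2 + 4 * kap γ (‖w - z‖ ^ 2) := by
  have h1 : HasFDerivAt (fun w : ℂ => ‖w - z‖ ^ 2) (2 • JJ (w - z)) w := by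
    have := ((hasFDerivAt_id (𝕜 := ℝ) w).sub_const z).norm_sq
    refine this.congr_fderiv ?_
    ext v
    simp [JJ_apply]
  have h2 := ((hk.differentiable (by simp)).differentiableAt (x := ‖w - z‖ ^ 2)).hasDerivAt.comp_hasFDerivAt w h1
  have h3 : HasFDerivAt (fun w : ℂ => JJ (w - z)) JJ w := by
    exact JJ.hasFDerivAt.comp w ((hasFDerivAt_id (𝕜 := ℝ) w).sub_const z)
  have h4 := (h2.const_mul 2).smul h3
  have h5 : fderiv ℝ (fderiv ℝ (phi γ b z)) w = (2 * kap γ (‖w - z‖ ^ 2)) •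
      JJ +
      ((2 : ℝ) • deriv (kap γ) (‖w - z‖ ^ 2) • (2 : ℝ) • JJ (w - z)).smulRight (JJ (w - z)) := by
    rw [phi_fderiv hk]
    refine HasFDerivAt.fderiv ?_
    convert! h4 using 1
    congr 1
    ext v
    simp [JJ_apply]
  have hn : ‖w - z‖ ^ 2 = (w - z).re ^ 2 + (w - z).im ^ 2 := by
    rw [Complex.sq_norm, Complex.normSq_apply]; ring
  rw [lap, iteratedFDeriv_two_apply, iteratedFDeriv_two_apply, h5]
  simp [JJ_apply, Complex.inner] at hn ⊢
  rw [hn]; ring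

lemma phi_lap' {γ : ℝ → ℝ} (hk : ContDiff ℝ (⊤ : ℕ∞) (kap γ))
    (b : ℝ) (z w : ℂ) {r : ℝ} (hr : 0 < r) (hw : ‖w - z‖ = r) :
    r * lap (phi γ b z) w = deriv γ r := by
  rw [phi_lap hk, hw]
  have e : γ =ᶠ[𝓝 r] fun t => 2 * t ^ 2 * kap γ (t ^ 2) := by
    filter_upwards [lt_mem_nhds hr] with t ht
    have := kap_sq (γ := γ) ht.le
    rw [eq_div_iff ht.ne'] at this
    rw [← this]; ring
  rw [e.deriv_eq]
  have h1 := HasDerivAt.comp r (h₂ := kap γ) (h := fun t => t ^ 2)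
    ((hk.differentiable (by simp)).differentiableAt (x := r ^ 2)).hasDerivAt (hasDerivAt_pow 2 r)
  have h2 := ((hasDerivAt_pow 2 r).const_mul 2).mul h1
  refine Eq.trans ?_ h2.deriv.symm
  simp; ring

lemma key_mu (μ : Measure ℂ) [IsLocallyFiniteMeasure μ] {γ : ℝ → ℝ}
    (hk : ContDiff ℝ (⊤ : ℕ∞) (kap γ)) {b : ℝ} (hb : 0 ≤ b) (h0 : ∀ x, b < x → γ x = 0) (z : ℂ) :
    ∫ w, phi γ b z w ∂μ = - ∫ t in Icc 0 b, γ t / t * (μ (closedBall z t)).toReal := by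
  set q : ℝ → ℝ := fun t => 2 * t * kap γ (t ^ 2) with hq
  have hqc : Continuous q := by have := hk.continuous; fun_prop
  have hfm : Fact (μ (closedBall z b) < ⊤) := ⟨(isCompact_closedBall z b).measure_lt_top⟩
  have e1 : ∫ w, phi γ b z w ∂μ = ∫ w in closedBall z b, phi γ b z w ∂μ := by
    symm
    apply setIntegral_eq_integral_of_forall_compl_eq_zero
    intro w hw
    apply kk_zero hb h0
    rw [mem_closedBall, dist_eq_norm] at hw
    push Not at hw
    gcongr
  set H : ℂ → ℝ → ℝ := fun w t => if ‖w - z‖ ≤ t then q t else 0 with hH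
  have e2 : ∀ w ∈ closedBall z b, phi γ b z w = - ∫ t in Icc 0 b, H w t := by
    intro w hw
    rw [mem_closedBall, dist_eq_norm] at hw
    rw [phi, kk_eq hk, intervalIntegral.integral_of_le hw, ← integral_Icc_eq_integral_Ioc]
    congr 1
    have : H w = (Ici ‖w - z‖).indicator q := by
      ext t; simp [hH, indicator, mem_Ici]
    rw [this, setIntegral_indicator measurableSet_Ici]
    congr 2
    ext t; simp only [mem_Icc, mem_inter_iff, mem_Ici]
    have := norm_nonneg (w - z)
    constructor
    · rintro ⟨h, h'⟩; exact ⟨⟨by linarith, h'⟩, h⟩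
    · rintro ⟨⟨h, h'⟩, h''⟩; exact ⟨h'', h'⟩
  rw [e1, setIntegral_congr_fun measurableSet_closedBall e2, integral_neg]
  congr 1
  obtain ⟨K, hK⟩ := (isCompact_Icc (a := (0 : ℝ)) (b := b)).exists_bound_of_continuousOn hqc.continuousOn
  have hHm : Measurable (Function.uncurry H) := by
    refine Measurable.ite ?_ (hqc.measurable.comp measurable_snd) measurable_const
    exact (isClosed_le (by fun_prop) (by fun_prop)).measurableSet
  have hint : Integrable (Function.uncurry H)
      ((μ.restrict (closedBall z b)).prod (volume.restrict (Icc 0 b))) := by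
    refine Integrable.of_bound hHm.aestronglyMeasurable (max K 0) ?_
    have : ∀ᵐ p ∂((μ.restrict (closedBall z b)).prod (volume.restrict (Icc 0 b))),
        p ∈ (univ ×ˢ Icc 0 b : Set (ℂ × ℝ)) := by
      rw [Measure.prod_restrict]
      have : ∀ᵐ p ∂((μ.prod volume).restrict (closedBall z b ×ˢ Icc 0 b)), p ∈ (closedBall z b ×ˢ Icc 0 b) :=
        ae_restrict_mem (measurableSet_closedBall.prod measurableSet_Icc)
      filter_upwards [this] with p hp using ⟨mem_univ _, hp.2⟩
    filter_upwards [this] with p hp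
    simp only [Function.uncurry, hH]
    split_ifs
    · exact (hK _ hp.2).trans (le_max_left _ _)
    · simp
  rw [integral_integral_swap hint]
  apply setIntegral_congr_fun measurableSet_Icc
  intro t ht
  have : (fun w => H w t) = (closedBall z t).indicator (fun _ => q t) := by
    ext w; simp [hH, indicator, dist_eq_norm]
  simp only [this]
  rw [setIntegral_indicator measurableSet_closedBall, setIntegral_const,
    inter_eq_right.2 (closedBall_subset_closedBall ht.2), ← kap_sq ht.1, smul_eq_mul, mul_comm]
  rfl

lemma key_u {u : ℂ → EReal} (hu : SubharmonicFn u) {z : ℂ} (hz : u z ≠ ⊥) {γ : ℝ → ℝ}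
    (hγ : ContDiff ℝ (⊤ : ℕ∞) γ)
    (hk : ContDiff ℝ (⊤ : ℕ∞) (kap γ)) {b : ℝ} (h0 : ∀ x, b < x → γ x = 0) :
    ∫ w, (u w).toReal * lap (phi γ b z) w = ∫ r in Ioi 0, Mf u z r * deriv γ r := by
  obtain ⟨C, hC0, hC⟩ := exists_C hu z b
  have hd0 : ∀ r, b < r → deriv γ r = 0 := by
    intro r hr
    have : γ =ᶠ[𝓝 r] fun _ => 0 := by
      filter_upwards [lt_mem_nhds hr] with x hx using h0 x hx
    rw [this.deriv_eq]; simp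
  have hdc : Continuous (deriv γ) := hγ.continuous_deriv (by simp)
  rw [← integral_add_left_eq_self _ z, ← Complex.integral_comp_polarCoord_symm]
  set G : ℝ × ℝ → ℝ := fun p => (u (circleMap z p.1 p.2)).toReal * deriv γ p.1 with hG
  have e1 : ∫ p in polarCoord.target, p.1 • ((u (z + Complex.polarCoord.symm p)).toReal *
      lap (phi γ b z) (z + Complex.polarCoord.symm p)) = ∫ p in Ioi (0 : ℝ) ×ˢ Ioo (-π) π, G p := by
    apply setIntegral_congr_fun (measurableSet_Ioi.prod measurableSet_Ioo)
    rintro ⟨r, θ⟩ ⟨hr, hθ⟩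
    have hr' : 0 < r := hr
    have hc : z + Complex.polarCoord.symm (r, θ) = circleMap z r θ := by
      simp [circleMap, Complex.exp_mul_I]
    simp only [hG, hc, smul_eq_mul]
    rw [← phi_lap' hk b z (circleMap z r θ) hr' (by simp [circleMap, Complex.norm_exp_ofReal_mul_I, abs_of_pos hr'])]
    ring
  rw [e1, Measure.volume_eq_prod, ← Measure.prod_restrict]
  have hGm : Measurable G := by
    refine Measurable.mul ?_ (hdc.measurable.comp measurable_fst)
    refine ((u_meas hu).comp (Continuous.measurable ?_)).ereal_toReal
    unfold circleMap; fun_prop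
  have hint : Integrable G ((volume.restrict (Ioi 0)).prod TT) := by
    rw [integrable_prod_iff hGm.aestronglyMeasurable]
    constructor
    · filter_upwards [ae_restrict_mem measurableSet_Ioi] with r hr
      have hr' : 0 < r := hr
      by_cases hrb : r ≤ b
      · exact (circ_basic hu hC0 hC hz hr'.le hrb).2.1.mul_const (deriv γ r)
      · simp [hG, hd0 r (not_le.1 hrb)]
    · set K := 2 * π * (2 * C - (u z).toReal)
      have hm : AEStronglyMeasurable (fun x => ∫ y, ‖G (x, y)‖ ∂TT) (volume.restrict (Ioi 0)) :=
        (hGm.norm.stronglyMeasurable.integral_prod_right' (ν := TT)).aestronglyMeasurable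
      have hgi : Integrable (fun r => K * (Icc 0 b).indicator (fun r => |deriv γ r|) r)
          (volume.restrict (Ioi 0)) := by
        refine Integrable.const_mul ?_ K
        refine Integrable.mono_measure ?_ Measure.restrict_le_self
        rw [integrable_indicator_iff measurableSet_Icc]
        exact hdc.abs.continuousOn.integrableOn_Icc
      refine hgi.mono' hm ?_
      filter_upwards [ae_restrict_mem measurableSet_Ioi] with r hr
      have hr' : 0 < r := hr
      rw [Real.norm_of_nonneg (integral_nonneg fun _ => norm_nonneg _)]
      simp only [hG, norm_mul, Real.norm_eq_abs]
      rw [integral_mul_const]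
      by_cases hrb : r ≤ b
      · rw [indicator_of_mem (show r ∈ Icc 0 b from ⟨hr'.le, hrb⟩)]
        exact mul_le_mul_of_nonneg_right (abs_bound hu hC0 hC hz hr'.le hrb) (abs_nonneg _)
      · simp [hd0 r (not_le.1 hrb), hrb]
  rw [integral_prod _ hint]
  congr 1
  ext r
  simp only [hG]
  rw [integral_mul_const]; rfl

lemma Mf_meas {u : ℂ → EReal} (hu : SubharmonicFn u) (z : ℂ) : Measurable (Mf u z) := by
  have hGm : Measurable (fun p : ℝ × ℝ => (u (circleMap z p.1 p.2)).toReal) := by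
    refine ((u_meas hu).comp (Continuous.measurable ?_)).ereal_toReal
    unfold circleMap; fun_prop
  exact (hGm.stronglyMeasurable.integral_prod_right' (ν := TT)).measurable

lemma key_id {u : ℂ → EReal} (hu : SubharmonicFn u) (μ : Measure ℂ) [IsLocallyFiniteMeasure μ]
    (hμ : IsRieszMeasure u μ) {z : ℂ} (hz : u z ≠ ⊥) {γ : ℝ → ℝ}
    (hγ : ContDiff ℝ (⊤ : ℕ∞) γ) {a b : ℝ} (ha : 0 < a) (hb : 0 ≤ b)
    (ha0 : ∀ x < a, γ x = 0) (h0 : ∀ x, b < x → γ x = 0) :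
    ∫ r in Ioi 0, Mf u z r * deriv γ r =
      - (2 * π * ∫ t in Icc 0 b, γ t / t * (μ (closedBall z t)).toReal) := by
  have hk := kap_smooth hγ ha ha0
  rw [← key_u hu hz hγ hk h0, hμ _ (phi_smooth hk b z) (phi_compact hb h0 z),
    key_mu μ hk hb h0 z]
  ring

lemma compact_pos {K : Set ℝ} (hK : IsCompact K) (h : K ⊆ Ioi 0) :
    ∃ a b : ℝ, 0 < a ∧ K ⊆ Icc a b := by
  rcases K.eq_empty_or_nonempty with rfl | hne
  · exact ⟨1, 1, one_pos, by simp⟩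
  · obtain ⟨a, ha⟩ := hK.exists_isLeast hne
    obtain ⟨b, hb⟩ := hK.exists_isGreatest hne
    exact ⟨a, b, h ha.1, fun x hx => ⟨ha.2 hx, hb.2 hx⟩⟩

lemma int_mul {G g : ℝ → ℝ} {a b : ℝ} (hG : IntegrableOn G (Icc a b)) (hg : Continuous g)
    (h0 : ∀ x ∉ Icc a b, g x = 0) : Integrable (fun x => G x * g x) := by
  have hs : Function.support (fun x => G x * g x) ⊆ Icc a b := by
    intro x hx
    by_contra h
    exact hx (by simp [h0 x h])
  rw [← integrableOn_iff_integrable_of_support_subset hs]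
  exact hG.mul_continuousOn hg.continuousOn isCompact_Icc

lemma du_bois {G : ℝ → ℝ} (hG : ∀ a b, 0 < a → IntegrableOn G (Icc a b))
    (h : ∀ γ : ℝ → ℝ, ContDiff ℝ (⊤ : ℕ∞) γ → ∀ a b, 0 < a → a ≤ b → (∀ x < a, γ x = 0) →
      (∀ x, b < x → γ x = 0) → ∫ x, G x * deriv γ x = 0) :
    ∃ c, ∀ᵐ x, x ∈ Ioi (0 : ℝ) → G x = c := by
  let B : ContDiffBump (2 : ℝ) := ⟨1 / 2, 1, by norm_num, by norm_num⟩
  set η : ℝ → ℝ := B.normed volume with hη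
  have hηs : ContDiff ℝ (⊤ : ℕ∞) η := B.contDiff_normed
  have hη0 : ∀ x ∉ Icc (1 : ℝ) 3, η x = 0 := by
    intro x hx
    by_contra hne
    have : x ∈ Function.support η := hne
    rw [hη, B.support_normed_eq] at this
    rw [mem_ball, Real.dist_eq, abs_lt] at this
    exact hx ⟨by linarith [this.1], by linarith [this.2]⟩
  have hη1 : ∫ x, η x = 1 := B.integral_normed
  refine ⟨∫ x, G x * η x, ?_⟩
  set c := ∫ x, G x * η x with hc
  have := IsOpen.ae_eq_zero_of_integral_contDiff_smul_eq_zero (μ := volume) (f := fun x => G x - c)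
    isOpen_Ioi (U := Ioi (0 : ℝ)) ?_ ?_
  · filter_upwards [this] with x hx hx0
    linarith [hx hx0]
  · rw [locallyIntegrableOn_iff isOpen_Ioi.isLocallyClosed]
    intro K hKs hK
    obtain ⟨a, b, ha, hab⟩ := compact_pos hK hKs
    have : IntegrableOn (fun x => G x - c) (Icc a b) :=
      (hG a b ha).sub (integrableOn_const (by simp))
    exact this.mono_set hab
  · intro g hg hgc hgs
    obtain ⟨a', b', ha', hab'⟩ := compact_pos hgc hgs
    set a := min a' 1
    set b := max b' 3
    have ha : 0 < a := lt_min ha' one_pos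
    have hab : a ≤ b := (min_le_right _ _).trans (le_trans (by norm_num) (le_max_right _ _))
    have hg0 : ∀ x ∉ Icc a b, g x = 0 := by
      intro x hx
      apply image_eq_zero_of_notMem_tsupport
      intro hx'
      have := hab' hx'
      exact hx ⟨(min_le_left _ _).trans this.1, this.2.trans (le_max_left _ _)⟩
    have hη0' : ∀ x ∉ Icc a b, η x = 0 := by
      intro x hx
      apply hη0
      intro this
      exact hx ⟨(min_le_right _ _).trans this.1, this.2.trans (le_max_right _ _)⟩
    set I := ∫ x, g x with hI
    set ψ : ℝ → ℝ := fun x => g x - I * η x with hψ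
    have hψs : ContDiff ℝ (⊤ : ℕ∞) ψ := hg.sub (contDiff_const.mul hηs)
    have hψ0 : ∀ x ∉ Icc a b, ψ x = 0 := fun x hx => by simp [hψ, hg0 x hx, hη0' x hx]
    have hgi : Integrable g := hg.continuous.integrable_of_hasCompactSupport hgc
    have hηi : Integrable η := hηs.continuous.integrable_of_hasCompactSupport B.hasCompactSupport_normed
    have hψI : ∫ x, ψ x = 0 := by
      rw [hψ, integral_sub hgi (hηi.const_mul I), integral_const_mul, hη1]; simp [hI]
    set γ : ℝ → ℝ := fun x => ∫ t in a..x, ψ t with hγ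
    have hγd : ∀ x, HasDerivAt γ (ψ x) x := fun x =>
      intervalIntegral.integral_hasDerivAt_right (hψs.continuous.intervalIntegrable _ _)
        (hψs.continuous.stronglyMeasurableAtFilter _ _) hψs.continuous.continuousAt
    have hγd' : deriv γ = ψ := funext fun x => (hγd x).deriv
    have hγs : ContDiff ℝ (⊤ : ℕ∞) γ := by
      rw [contDiff_infty_iff_deriv, hγd']
      exact ⟨fun x => (hγd x).differentiableAt, hψs⟩
    have h1 := h γ hγs a b ha hab ?_ ?_
    · rw [hγd'] at h1
      have e : ∀ x, g x • (G x - c) = G x * ψ x + (I * (G x * η x) - c * g x) := by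
        intro x; simp only [hψ, smul_eq_mul]; ring
      simp_rw [e]
      rw [integral_add, h1, integral_sub, integral_const_mul, integral_const_mul]
      · rw [← hI, ← hc]; ring
      · exact (int_mul (hG a b ha) hηs.continuous hη0').const_mul I
      · exact hgi.const_mul c
      · exact int_mul (hG a b ha) hψs.continuous hψ0
      · exact ((int_mul (hG a b ha) hηs.continuous hη0').const_mul I).sub (hgi.const_mul c)
    · intro x hx
      simp only [hγ]
      rw [intervalIntegral.integral_symm, intervalIntegral.integral_of_le hx.le,
        integral_Ioc_eq_integral_Ioo,
        setIntegral_eq_zero_of_forall_eq_zero, neg_zero]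
      intro t ht
      exact hψ0 t fun h => absurd h.1 (not_le.2 ht.2)
    · intro x hx
      simp only [hγ]
      rw [intervalIntegral.integral_of_le (hab.trans hx.le), ← integral_Icc_eq_integral_Ioc,
        setIntegral_eq_integral_of_forall_compl_eq_zero, hψI]
      intro t ht
      exact hψ0 t fun h => ht ⟨h.1, h.2.trans hx.le⟩

noncomputable def ff (μ : Measure ℂ) (z : ℂ) (t : ℝ) : ℝ := (μ (closedBall z t)).toReal / t

lemma ff_nonneg (μ : Measure ℂ) (z : ℂ) {t : ℝ} (ht : 0 ≤ t) : 0 ≤ ff μ z t := by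
  unfold ff; positivity

lemma ff_int (μ : Measure ℂ) [IsLocallyFiniteMeasure μ] (z : ℂ) {a b : ℝ} (ha : 0 < a) (hb : 0 < b) :
    IntervalIntegrable (ff μ z) volume a b := by
  have h1 : Monotone fun t => (μ (closedBall z t)).toReal := by
    intro s t hst
    exact ENNReal.toReal_mono (isCompact_closedBall z t).measure_lt_top.ne
      (measure_mono (closedBall_subset_closedBall hst))
  have h2 : IntervalIntegrable (fun t => (μ (closedBall z t)).toReal) volume a b :=
    h1.intervalIntegrable
  have := h2.mul_continuousOn (g := fun t => t⁻¹) (by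
    apply ContinuousOn.inv₀ continuousOn_id
    intro x hx
    have := (lt_min ha hb).trans_le hx.1
    exact this.ne')
  exact this.congr (fun x _ => by simp [ff, div_eq_mul_inv])

noncomputable def FF (μ : Measure ℂ) (z : ℂ) (r : ℝ) : ℝ := ∫ t in (1 : ℝ)..r, ff μ z t

lemma FF_ac (μ : Measure ℂ) [IsLocallyFiniteMeasure μ] (z : ℂ) {a b : ℝ} (ha : 0 < a) (ha1 : a ≤ 1)
    (hb : 1 ≤ b) : AbsolutelyContinuousOnInterval (FF μ z) a b :=
  (ff_int μ z ha (by linarith)).absolutelyContinuousOnInterval_intervalIntegral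
    (by rw [uIcc_of_le (by linarith)]; exact ⟨ha1, hb⟩)

lemma FF_cont (μ : Measure ℂ) [IsLocallyFiniteMeasure μ] (z : ℂ) {r : ℝ} (hr : 0 < r) :
    ContinuousAt (FF μ z) r := by
  have ha : 0 < min (r / 2) 1 := lt_min (by linarith) one_pos
  have := (FF_ac μ z ha (min_le_right _ _) (le_max_right (r + 1) 1)).continuousOn
  rw [uIcc_of_le ((min_le_right _ _).trans (le_max_right _ _))] at this
  apply this.continuousAt
  apply Icc_mem_nhds
  · exact (min_le_left _ _).trans_lt (by linarith)
  · exact lt_of_lt_of_le (by linarith) (le_max_left _ _)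

lemma FF_sub (μ : Measure ℂ) [IsLocallyFiniteMeasure μ] (z : ℂ) {r s : ℝ} (hr : 0 < r) (hs : 0 < s) :
    FF μ z s - FF μ z r = ∫ t in r..s, ff μ z t :=
  intervalIntegral.integral_interval_sub_left (ff_int μ z one_pos hs) (ff_int μ z one_pos hr)

lemma FF_mono (μ : Measure ℂ) [IsLocallyFiniteMeasure μ] (z : ℂ) {r s : ℝ} (hr : 0 < r) (hrs : r ≤ s) :
    FF μ z r ≤ FF μ z s := by
  have h := FF_sub μ z hr (hr.trans_le hrs)
  have : 0 ≤ ∫ t in r..s, ff μ z t :=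
    intervalIntegral.integral_nonneg hrs fun t ht => ff_nonneg μ z (hr.le.trans ht.1)
  linarith

lemma FF_ibp (μ : Measure ℂ) [IsLocallyFiniteMeasure μ] (z : ℂ) {γ : ℝ → ℝ}
    (hγ : ContDiff ℝ (⊤ : ℕ∞) γ) {a b : ℝ} (ha : 0 < a) (hab : a ≤ b) (ha0 : ∀ x < a, γ x = 0)
    (h0 : ∀ x, b < x → γ x = 0) (hd0 : ∀ x ∉ Icc a b, deriv γ x = 0) :
    ∫ r, FF μ z r * deriv γ r = - ∫ t in Icc 0 b, γ t / t * (μ (closedBall z t)).toReal := by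
  set a' := min (a / 2) 1
  set b' := max (b + 1) 1
  have ha' : 0 < a' := lt_min (by linarith) one_pos
  have haa : a' < a := (min_le_left _ _).trans_lt (by linarith)
  have hbb : b < b' := lt_of_lt_of_le (by linarith) (le_max_left _ _)
  have hab' : a' ≤ b' := by linarith
  have hF := FF_ac μ z ha' (min_le_right _ _) (le_max_right (b + 1) 1)
  have hg : AbsolutelyContinuousOnInterval γ a' b' :=
    ContDiffOn.absolutelyContinuousOnInterval (hγ.contDiffOn.of_le (by simp))
  have key := hF.integral_mul_deriv_eq_deriv_mul hg
  rw [ha0 a' haa, h0 b' hbb] at key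
  have e1 : ∫ r, FF μ z r * deriv γ r = ∫ r in a'..b', FF μ z r * deriv γ r := by
    rw [intervalIntegral.integral_of_le hab', ← integral_Icc_eq_integral_Ioc]
    symm
    apply setIntegral_eq_integral_of_forall_compl_eq_zero
    intro x hx
    rw [hd0 x fun h => hx ⟨haa.le.trans h.1, h.2.trans hbb.le⟩, mul_zero]
  have e2 : ∫ t in Icc 0 b, γ t / t * (μ (closedBall z t)).toReal = ∫ t, ff μ z t * γ t := by
    have : ∀ t, γ t / t * (μ (closedBall z t)).toReal = ff μ z t * γ t := fun t => by
      rw [ff]; ring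
    simp_rw [this]
    apply setIntegral_eq_integral_of_forall_compl_eq_zero
    intro x hx
    have : γ x = 0 := by
      by_cases hx0 : x < a
      · exact ha0 x hx0
      · exact h0 x (by by_contra h; exact hx ⟨by linarith, by linarith⟩)
    rw [this, mul_zero]
  have e3 : ∫ t, ff μ z t * γ t = ∫ t in a'..b', ff μ z t * γ t := by
    rw [intervalIntegral.integral_of_le hab', ← integral_Icc_eq_integral_Ioc]
    symm
    apply setIntegral_eq_integral_of_forall_compl_eq_zero
    intro x hx
    have : γ x = 0 := by
      by_cases hx0 : x < a
      · exact ha0 x hx0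
      · exact h0 x (by by_contra h; exact hx ⟨by linarith, by linarith⟩)
    rw [this, mul_zero]
  have e4 : ∫ t in a'..b', deriv (FF μ z) t * γ t = ∫ t in a'..b', ff μ z t * γ t := by
    apply intervalIntegral.integral_congr_ae
    have hi : IntervalIntegrable (ff μ z) volume a' b' := ff_int μ z ha' (by linarith)
    filter_upwards [hi.ae_hasDerivAt_integral] with x hx hxm
    have := hx (uIoc_subset_uIcc hxm) 1 (by
      rw [uIcc_of_le hab']; exact ⟨min_le_right _ _, le_max_right _ _⟩)
    rw [show deriv (FF μ z) x = ff μ z x from this.deriv]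
  rw [e1, key, e2, e3, e4]; ring

lemma M_intOn {u : ℂ → EReal} (hu : SubharmonicFn u) {z : ℂ} (hz : u z ≠ ⊥) (a b : ℝ) (ha : 0 < a) :
    IntegrableOn (Mf u z) (Icc a b) := by
  obtain ⟨C, hC0, hC⟩ := exists_C hu z b
  have : IsFiniteMeasure (volume.restrict (Icc a b)) := ⟨by simp⟩
  refine Integrable.of_bound (Mf_meas hu z).aestronglyMeasurable
    (max |2 * π * C| |2 * π * (u z).toReal|) ?_
  filter_upwards [ae_restrict_mem measurableSet_Icc] with r hr
  obtain ⟨_, _, _, h4, h5⟩ := circ_basic hu hC0 hC hz (ha.le.trans hr.1) hr.2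
  rw [Real.norm_eq_abs]
  rw [max_comm]
  exact abs_le_max_abs_abs h5 h4

lemma M_ae {u : ℂ → EReal} (hu : SubharmonicFn u) (μ : Measure ℂ) [IsLocallyFiniteMeasure μ]
    (hμ : IsRieszMeasure u μ) {z : ℂ} (hz : u z ≠ ⊥) :
    ∃ c, ∀ᵐ x, x ∈ Ioi (0 : ℝ) → Mf u z x = c + 2 * π * FF μ z x := by
  have hFi : ∀ a b, 0 < a → IntegrableOn (FF μ z) (Icc a b) := by
    intro a b ha
    apply ContinuousOn.integrableOn_Icc
    intro x hx
    exact (FF_cont μ z (ha.trans_le hx.1)).continuousWithinAt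
  suffices h : ∃ c, ∀ᵐ x, x ∈ Ioi (0 : ℝ) → Mf u z x - 2 * π * FF μ z x = c by
    obtain ⟨c, hc⟩ := h
    refine ⟨c, ?_⟩
    filter_upwards [hc] with x hx hx0
    linarith [hx hx0]
  apply du_bois
  · intro a b ha
    exact (M_intOn hu hz a b ha).sub ((hFi a b ha).const_mul _)
  · intro γ hγ a b ha hab ha0 h0
    have hd0 : ∀ x ∉ Icc a b, deriv γ x = 0 := by
      intro x hx
      have : γ =ᶠ[𝓝 x] fun _ => 0 := by
        by_cases hxa : x < a
        · filter_upwards [gt_mem_nhds hxa] with y hy using ha0 y hy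
        · have : b < x := by by_contra h; exact hx ⟨by linarith, by linarith⟩
          filter_upwards [lt_mem_nhds this] with y hy using h0 y hy
      rw [this.deriv_eq]; simp
    have hdc : Continuous (deriv γ) := hγ.continuous_deriv (by simp)
    have h1 := key_id hu μ hμ hz hγ ha (ha.le.trans hab) ha0 h0
    rw [setIntegral_eq_integral_of_forall_compl_eq_zero (by
      intro x hx
      rw [hd0 x fun h => hx (ha.trans_le h.1), mul_zero])] at h1
    have h2 := FF_ibp μ z hγ ha hab ha0 h0 hd0
    have e : ∀ x, (Mf u z x - 2 * π * FF μ z x) * deriv γ x =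
      Mf u z x * deriv γ x - 2 * π * (FF μ z x * deriv γ x) := fun x => by ring
    simp_rw [e]
    rw [integral_sub (int_mul (M_intOn hu hz a b ha) hdc hd0)
      ((int_mul (hFi a b ha) hdc hd0).const_mul _), integral_const_mul, h1, h2]
    ring

lemma null_polar {Z : Set ℝ} (hZ : volume Z = 0) (ρ : ℂ) :
    ∀ᵐ s ∂(volume.restrict (Ioi (0 : ℝ))), ∀ᵐ α ∂TT, ‖circleMap ρ s α‖ ∉ Z := by
  set Z' := toMeasurable volume Z
  have hZ' : volume Z' = 0 := by rw [measure_toMeasurable, hZ]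
  have hZm : MeasurableSet Z' := measurableSet_toMeasurable _ _
  set A : Set ℂ := {ζ | ‖ζ‖ ∈ Z'}
  have hAm : MeasurableSet A := measurable_norm hZm
  have hA : volume A = 0 := by
    rw [← lintegral_indicator_one hAm, ← Complex.lintegral_comp_polarCoord_symm]
    rw [lintegral_eq_zero_iff']
    · have h1 : ∀ᵐ p : ℝ × ℝ ∂((volume : Measure ℝ).prod volume), p.1 ∉ Z' :=
        Measure.quasiMeasurePreserving_fst.ae (measure_eq_zero_iff_ae_notMem.1 hZ')
      rw [← Measure.volume_eq_prod] at h1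
      filter_upwards [ae_restrict_of_ae h1, ae_restrict_mem polarCoord.open_target.measurableSet]
        with p hp hpt
      have hp0 : 0 < p.1 := hpt.1
      have : Complex.polarCoord.symm p ∉ A := by
        change ‖Complex.polarCoord.symm p‖ ∉ Z'
        rw [Complex.norm_polarCoord_symm, abs_of_pos hp0]; exact hp
      change ENNReal.ofReal p.1 • A.indicator 1 (Complex.polarCoord.symm p) = (0 : ENNReal)
      rw [indicator_of_notMem this, smul_zero]
    · apply Measurable.aemeasurable
      refine Measurable.smul (f := fun p : ℝ × ℝ => ENNReal.ofReal p.1) (measurable_fst.ennreal_ofReal) ?_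
      refine (measurable_one.indicator hAm).comp ?_
      exact Continuous.measurable (by
        rw [show ⇑Complex.polarCoord.symm = _ from funext Complex.polarCoord_symm_apply]
        fun_prop)
  set B : Set ℂ := {ζ | ρ + ζ ∈ A}
  have hBm : MeasurableSet B := (measurable_const_add ρ) hAm
  have hB : volume B = 0 := by
    have := measure_preimage_add volume ρ A
    rw [hA] at this; exact this
  rw [← lintegral_indicator_one hBm, ← Complex.lintegral_comp_polarCoord_symm,
    lintegral_eq_zero_iff'] at hB
  · have h2 : ∀ᵐ p ∂((volume.restrict (Ioi (0 : ℝ))).prod TT), ‖circleMap ρ p.1 p.2‖ ∉ Z := by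
      rw [TT, Measure.prod_restrict, ← Measure.volume_eq_prod]
      filter_upwards [hB, ae_restrict_mem polarCoord.open_target.measurableSet] with p hp hpt hpZ
      have hp0 : 0 < p.1 := hpt.1
      have : Complex.polarCoord.symm p ∈ B := by
        change ‖ρ + Complex.polarCoord.symm p‖ ∈ Z'
        apply subset_toMeasurable
        convert hpZ using 2
        simp [circleMap, Complex.exp_mul_I]
      change ENNReal.ofReal p.1 • B.indicator 1 (Complex.polarCoord.symm p) = (0 : ENNReal) at hp
      rw [indicator_of_mem this] at hp
      simp at hp
      linarith
    exact Measure.ae_ae_of_ae_prod h2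
  · apply Measurable.aemeasurable
    refine Measurable.smul (f := fun p : ℝ × ℝ => ENNReal.ofReal p.1) (measurable_fst.ennreal_ofReal) ?_
    refine (measurable_one.indicator hBm).comp ?_
    exact Continuous.measurable (by
        rw [show ⇑Complex.polarCoord.symm = _ from funext Complex.polarCoord_symm_apply]
        fun_prop)

lemma seq_of_ae {P : ℝ → Prop} {a : ℝ} (h : ∀ᵐ x, a < x → P x) :
    ∃ r : ℕ → ℝ, (∀ n, a < r n ∧ P (r n)) ∧ Tendsto r atTop (𝓝 a) := by
  have : ∀ n : ℕ, ∃ x, x ∈ Ioo a (a + 1 / ((n : ℝ) + 1)) ∧ P x := by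
    intro n
    by_contra! hcon
    have h1 : volume (Ioo a (a + 1 / ((n : ℝ) + 1))) = 0 := by
      rw [measure_eq_zero_iff_ae_notMem]
      filter_upwards [h] with x hx hxm
      exact hcon x hxm (hx hxm.1)
    rw [Real.volume_Ioo, ENNReal.ofReal_eq_zero] at h1
    have : (0 : ℝ) < 1 / ((n : ℝ) + 1) := by positivity
    linarith
  choose r hr hP using this
  refine ⟨r, fun n => ⟨(hr n).1, hP n⟩, ?_⟩
  refine tendsto_of_tendsto_of_tendsto_of_le_of_le tendsto_const_nhds ?_
    (fun n => (hr n).1.le) (fun n => (hr n).2.le)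
  have := (tendsto_const_nhds (x := a)).add (tendsto_one_div_add_atTop_nhds_zero_nat (𝕜 := ℝ))
  simpa using this

lemma M_eq {u : ℂ → EReal} (hu : SubharmonicFn u) (μ : Measure ℂ) [IsLocallyFiniteMeasure μ]
    (hμ : IsRieszMeasure u μ) {z : ℂ} (hz : u z ≠ ⊥) :
    ∃ c, ∀ x, 0 < x → Mf u z x = c + 2 * π * FF μ z x := by
  obtain ⟨c, hc⟩ := M_ae hu μ hμ hz
  refine ⟨c, fun ρ hρ => le_antisymm ?_ ?_⟩
  · set Z : Set ℝ := {x | ¬ (x ∈ Ioi (0 : ℝ) → Mf u z x = c + 2 * π * FF μ z x)}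
    have hZ : volume Z = 0 := hc
    have h1 := null_polar hZ (ρ : ℂ)
    rw [ae_restrict_iff' measurableSet_Ioi] at h1
    obtain ⟨s, hs, hst⟩ := seq_of_ae (a := 0) (P := fun s => ∀ᵐ α ∂TT, ‖circleMap (ρ : ℂ) s α‖ ∉ Z) h1
    have hlim : Tendsto (fun n => c + 2 * π * FF μ z (ρ + s n)) atTop (𝓝 (c + 2 * π * FF μ z ρ)) := by
      apply Tendsto.const_add
      apply Tendsto.const_mul
      apply (FF_cont μ z hρ).tendsto.comp
      have := (tendsto_const_nhds (x := ρ)).add hst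
      simpa using this
    refine ge_of_tendsto hlim ?_
    filter_upwards [hst.eventually (gt_mem_nhds hρ)] with n hn
    have hs0 := (hs n).1
    apply M_le hu hz hρ.le hs0
    filter_upwards [(hs n).2] with α hα
    have hup : ‖circleMap (ρ : ℂ) (s n) α‖ ≤ ρ + s n := by
      unfold circleMap
      refine (norm_add_le _ _).trans ?_
      simp [Complex.norm_exp_ofReal_mul_I, abs_of_pos hρ, abs_of_pos hs0]
    have hlow : 0 < ‖circleMap (ρ : ℂ) (s n) α‖ := by
      rw [norm_pos_iff]
      intro h0
      unfold circleMap at h0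
      have := congrArg norm (eq_neg_of_add_eq_zero_left h0)
      simp [Complex.norm_exp_ofReal_mul_I, abs_of_pos hρ, abs_of_pos hs0] at this
      linarith
    have hgood : Mf u z ‖circleMap (ρ : ℂ) (s n) α‖ = c + 2 * π * FF μ z ‖circleMap (ρ : ℂ) (s n) α‖ := by
      by_contra hne
      exact hα fun hh => hne (hh hlow)
    rw [hgood]
    have := FF_mono μ z hlow hup
    gcongr
  · have hc' : ∀ᵐ x, ρ < x → Mf u z x = c + 2 * π * FF μ z x := by
      filter_upwards [hc] with x hx h using hx (hρ.trans h)
    obtain ⟨r, hr, hrt⟩ := seq_of_ae hc'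
    apply M_usc hu hz hρ.le (fun n => (hρ.trans (hr n).1).le) hrt
    simp_rw [fun n => (hr n).2]
    apply Tendsto.const_add
    apply Tendsto.const_mul
    exact (FF_cont μ z hρ).tendsto.comp hrt

lemma Mf_zero (u : ℂ → EReal) (z : ℂ) : Mf u z 0 = 2 * π * (u z).toReal := by
  simp only [Mf, circleMap_zero_radius, Function.const_apply]
  rw [integral_const, TT_real_univ, smul_eq_mul]

lemma final {u : ℂ → EReal} (hu : SubharmonicFn u) (μ : Measure ℂ) [IsLocallyFiniteMeasure μ]
    (hμ : IsRieszMeasure u μ) {z : ℂ} (hz : u z ≠ ⊥) {ρ : ℝ} (hρ : 0 < ρ) :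
    Mf u z ρ = 2 * π * (u z).toReal + 2 * π * ∫ t in Ioc 0 ρ, ff μ z t := by
  obtain ⟨c, hc⟩ := M_eq hu μ hμ hz
  obtain ⟨C, hC0, hC⟩ := exists_C hu z ρ
  set r : ℕ → ℝ := fun n => ρ / ((n : ℝ) + 1) with hr
  have hr0 : ∀ n, 0 < r n := fun n => by simp only [hr]; positivity
  have hra : Antitone r := by
    intro m n hmn
    have : (m : ℝ) ≤ n := by exact_mod_cast hmn
    simp only [hr]; gcongr
  have hrρ : ∀ n, r n ≤ ρ := fun n => by
    have := hra (Nat.zero_le n); simpa [hr] using this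
  have hrt : Tendsto r atTop (𝓝 0) := by
    have := (tendsto_one_div_add_atTop_nhds_zero_nat (𝕜 := ℝ)).const_mul ρ
    simpa [hr, div_eq_mul_inv] using this
  have hMa : Antitone (fun n => Mf u z (r n)) := by
    intro m n hmn
    simp only [hc _ (hr0 _)]
    have := FF_mono μ z (hr0 n) (hra hmn)
    gcongr
  have hMb : ∀ n, 2 * π * (u z).toReal ≤ Mf u z (r n) := fun n =>
    (circ_basic hu hC0 hC hz (hr0 n).le (hrρ n)).2.2.2.2
  have hbdd : BddBelow (range fun n => Mf u z (r n)) :=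
    ⟨2 * π * (u z).toReal, by rintro _ ⟨n, rfl⟩; exact hMb n⟩
  have hlim := tendsto_atTop_ciInf hMa hbdd
  set L := ⨅ n, Mf u z (r n)
  have hL1 : L ≤ 2 * π * (u z).toReal := by
    rw [← Mf_zero]
    exact M_usc hu hz le_rfl (fun n => (hr0 n).le) hrt hlim
  have hL2 : 2 * π * (u z).toReal ≤ L := ge_of_tendsto' hlim hMb
  have hL : L = 2 * π * (u z).toReal := le_antisymm hL1 hL2
  have hI : ∀ n, 2 * π * ∫ t in Ioc (r n) ρ, ff μ z t = Mf u z ρ - Mf u z (r n) := by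
    intro n
    rw [← intervalIntegral.integral_of_le (hrρ n), ← FF_sub μ z (hr0 n) hρ, hc _ (hr0 n), hc _ hρ]
    ring
  have hint : IntegrableOn (ff μ z) (Ioc 0 ρ) := by
    refine integrableOn_Ioc_of_intervalIntegral_norm_bounded_left (l := atTop) (a := r)
      (I := (2 * π)⁻¹ * (Mf u z ρ - 2 * π * (u z).toReal)) (fun n => ?_) hrt
      (Eventually.of_forall fun n => ?_)
    · exact (ff_int μ z (hr0 n) hρ).1
    · have e : ∫ t in Ioc (r n) ρ, ‖ff μ z t‖ = ∫ t in Ioc (r n) ρ, ff μ z t := by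
        apply setIntegral_congr_fun measurableSet_Ioc
        intro t ht
        exact Real.norm_of_nonneg (ff_nonneg μ z ((hr0 n).trans ht.1).le)
      rw [e, inv_mul_eq_div, le_div_iff₀ (by positivity)]
      have := hI n
      have := hMb n
      linarith
  have hlim2 : Tendsto (fun n => ∫ t in Ioc (r n) ρ, ff μ z t) atTop (𝓝 (∫ t in Ioc 0 ρ, ff μ z t)) := by
    have := (aecover_Ioc_of_Ioc (μ := volume) hrt (tendsto_const_nhds (x := ρ))).integral_tendsto_of_countably_generated hint
    refine this.congr fun n => ?_
    rw [Measure.restrict_restrict measurableSet_Ioc, inter_eq_left.2 (Ioc_subset_Ioc_left (hr0 n).le)]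
  have h1 := hlim2.const_mul (2 * π)
  simp_rw [hI] at h1
  have h2 := tendsto_nhds_unique h1 (tendsto_const_nhds.sub hlim)
  rw [h2, hL]; ring

/-- Poisson–Jensen–Privalov: for `u ≢ -∞` subharmonic on `ℂ` with Riesz
measure `μ`, a point `z` with `u(z) > -∞`, and `ρ > 0`, the circular mean of `u` on
`∂D(z,ρ)` equals `u(z) + ∫₀^ρ μ(D̄(z,t))/t dt`. -/
theorem stmt7 (u : ℂ → EReal) (hu : SubharmonicFn u) (hne : ∃ w, u w ≠ ⊥)
    (μ : Measure ℂ) [IsLocallyFiniteMeasure μ] (hμ : IsRieszMeasure u μ)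
    (z : ℂ) (hz : u z ≠ ⊥) (ρ : ℝ) (hρ : 0 < ρ) :
    (2 * Real.pi)⁻¹ * ∫ θ in (0 : ℝ)..(2 * Real.pi),
        (u (z + ρ * Complex.exp (θ * Complex.I))).toReal
      = (u z).toReal +
        ∫ t in Set.Ioc (0 : ℝ) ρ, (μ (Metric.closedBall z t)).toReal / t := by
  have h := final hu μ hμ hz hρ
  have h4 := per_int (fun p => (u p).toReal) z ρ
  simp only [circleMap] at h4
  have h5 : ∫ θ in (0 : ℝ)..(2 * Real.pi),
        (u (z + ρ * Complex.exp (θ * Complex.I))).toReal = Mf u z ρ := h4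
  rw [h5, h, ← mul_add, inv_mul_cancel_left₀ (by positivity)]
  rfl
end

section
/- Let u ≢ -∞ be subharmonic on ℂ with Riesz measure Δ_u, and let z ∈ ℂ with u(z) = -∞. Then for every ρ > 0, ∫₀^ρ Δ_u(D̄(z,t))/t dt = +∞. -/
open MeasureTheory Metric Set Real ENNReal

theorem lap_radial (h h1 h2 : ℝ → ℝ) (z w : ℂ)
    (hh : ∀ s, 0 ≤ s → HasDerivAt h (h1 s) s) (hh1 : ∀ s, 0 ≤ s → HasDerivAt h1 (h2 s) s) :
    lap (fun y : ℂ => h (Complex.normSq (y - z))) w =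
      4 * (h1 (Complex.normSq (w - z)) + Complex.normSq (w - z) * h2 (Complex.normSq (w - z))) := by
  have hN : ∀ y : ℂ, HasFDerivAt (fun y : ℂ => Complex.normSq (y - z))
      ((2 * (y - z).re) • Complex.reCLM + (2 * (y - z).im) • Complex.imCLM) y := by
    intro y
    have hre : HasFDerivAt (fun y : ℂ => (y - z).re) Complex.reCLM y := by
      simpa using (Complex.reCLM.hasFDerivAt (x := y)).sub_const z.re
    have him : HasFDerivAt (fun y : ℂ => (y - z).im) Complex.imCLM y := by
      simpa using (Complex.imCLM.hasFDerivAt (x := y)).sub_const z.im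
    have := (hre.mul hre).add (him.mul him)
    have e : (2 * (y - z).re) • Complex.reCLM + (2 * (y - z).im) • Complex.imCLM =
        (y - z).re • Complex.reCLM + (y - z).re • Complex.reCLM +
        ((y - z).im • Complex.imCLM + (y - z).im • Complex.imCLM) := by
      module
    rw [e]
    exact this
  have hd1 : ∀ y : ℂ, fderiv ℝ (fun y : ℂ => h (Complex.normSq (y - z))) y =
      h1 (Complex.normSq (y - z)) • ((2 * (y - z).re) • Complex.reCLM + (2 * (y - z).im) • Complex.imCLM) := by
    intro y
    exact ((hh _ (Complex.normSq_nonneg (y - z))).comp_hasFDerivAt y (hN y)).fderiv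
  have e1 := (hh1 _ (Complex.normSq_nonneg (w-z))).comp_hasFDerivAt w (hN w)
  have hre : HasFDerivAt (fun y : ℂ => (y - z).re) Complex.reCLM w := by
    simpa using (Complex.reCLM.hasFDerivAt (x := w)).sub_const z.re
  have him : HasFDerivAt (fun y : ℂ => (y - z).im) Complex.imCLM w := by
    simpa using (Complex.imCLM.hasFDerivAt (x := w)).sub_const z.im
  have key := e1.smul (((hre.const_mul 2).smul_const Complex.reCLM).add
    ((him.const_mul 2).smul_const Complex.imCLM))
  have hd2 := key.fderiv
  have h3 : fderiv ℝ (fun y : ℂ => h (Complex.normSq (y - z))) = _ := funext hd1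
  rw [lap, iteratedFDeriv_two_apply, iteratedFDeriv_two_apply, h3]
  erw [hd2]
  have : Complex.normSq (w - z) = (w.re - z.re)^2 + (w.im - z.im)^2 := by
    rw [Complex.normSq_apply]; simp; ring
  simp
  generalize h2 (Complex.normSq (w-z)) = b
  rw [this]
  ring

theorem exists_T : ∃ T T1 T2 : ℝ → ℝ, ∃ C : ℝ, (∀ x, HasDerivAt T (T1 x) x) ∧
    (∀ x, HasDerivAt T1 (T2 x) x) ∧ ContDiff ℝ 2 T ∧ (∀ x, 0 ≤ T1 x) ∧ (∀ x, T1 x ≤ 1) ∧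
    (∀ x, 1 < x → T1 x = 1) ∧ (∀ x, x < 0 → T1 x = 0) ∧ (∀ x, 1 < x → T2 x = 0) ∧
    (∀ x, x < 0 → T2 x = 0) ∧ (∀ x, |T2 x| ≤ C) ∧ (∀ x, x ≤ 0 → T x = 0) ∧ (∀ x, 0 ≤ T x) ∧
    (∀ x, 0 ≤ x → T x ≤ x) := by
  have hs : ContDiff ℝ 1 Real.smoothTransition := Real.smoothTransition.contDiff
  have hc : Continuous Real.smoothTransition := hs.continuous
  have hT : ∀ x, HasDerivAt (fun x => ∫ t in (0:ℝ)..x, Real.smoothTransition t) (Real.smoothTransition x) x :=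
    fun x => intervalIntegral.integral_hasDerivAt_right (hc.intervalIntegrable _ _)
      (hc.stronglyMeasurableAtFilter _ _) hc.continuousAt
  have hT1 : ∀ x, HasDerivAt Real.smoothTransition (deriv Real.smoothTransition x) x :=
    fun x => (hs.differentiable (by norm_num) x).hasDerivAt
  have hc2 : Continuous (deriv Real.smoothTransition) := hs.continuous_deriv le_rfl
  have hpos : ∀ x, 1 < x → deriv Real.smoothTransition x = 0 := by
    intro x hx
    have : Real.smoothTransition =ᶠ[nhds x] fun _ => 1 := by
      filter_upwards [lt_mem_nhds hx] with y hy
      exact Real.smoothTransition.one_of_one_le hy.le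
    rw [this.deriv_eq]; simp
  have hneg : ∀ x, x < 0 → deriv Real.smoothTransition x = 0 := by
    intro x hx
    have : Real.smoothTransition =ᶠ[nhds x] fun _ => 0 := by
      filter_upwards [gt_mem_nhds hx] with y hy
      exact Real.smoothTransition.zero_of_nonpos hy.le
    rw [this.deriv_eq]; simp
  obtain ⟨C, hC⟩ := (isCompact_Icc (a := (0:ℝ)) (b := 1)).exists_bound_of_continuousOn hc2.continuousOn
  have hz : ∀ x, x ≤ 0 → ∫ t in (0:ℝ)..x, Real.smoothTransition t = 0 := by
    intro x hx
    rw [intervalIntegral.integral_symm, neg_eq_zero]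
    rw [intervalIntegral.integral_congr (g := fun _ => (0:ℝ))]
    · simp
    · intro t ht
      rw [uIcc_of_le hx] at ht
      exact Real.smoothTransition.zero_of_nonpos ht.2
  refine ⟨fun x => ∫ t in (0:ℝ)..x, Real.smoothTransition t, Real.smoothTransition,
    deriv Real.smoothTransition, C, hT, hT1, ?_, Real.smoothTransition.nonneg, Real.smoothTransition.le_one,
    fun x hx => Real.smoothTransition.one_of_one_le hx.le,
    fun x hx => Real.smoothTransition.zero_of_nonpos hx.le, hpos, hneg, ?_, hz, ?_, ?_⟩
  · rw [show (2 : WithTop ℕ∞) = 1 + 1 by norm_num, contDiff_succ_iff_deriv]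
    refine ⟨fun x => (hT x).differentiableAt, by simp, ?_⟩
    rw [funext fun x => (hT x).deriv]
    exact hs
  · intro x
    rcases lt_or_ge x 0 with h | h
    · rw [hneg x h, abs_zero]; exact (norm_nonneg _).trans (hC 0 (by simp))
    rcases lt_or_ge 1 x with h' | h'
    · rw [hpos x h', abs_zero]; exact (norm_nonneg _).trans (hC 0 (by simp))
    exact hC x ⟨h, h'⟩
  · intro x
    rcases le_total x 0 with h | h
    · exact (hz x h).ge
    · exact intervalIntegral.integral_nonneg h fun t _ => Real.smoothTransition.nonneg t
  · intro x hx
    have := intervalIntegral.integral_mono_on hx (hc.intervalIntegrable _ _)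
      (intervalIntegrable_const (c := (1:ℝ)) (μ := volume)) fun t _ => Real.smoothTransition.le_one t
    simpa using this

theorem bdd_above (u : ℂ → EReal) (hu : SubharmonicFn u) (w : ℂ) (R : ℝ) (hR : 0 ≤ R) :
    ∃ M : ℝ, 0 ≤ M ∧ ∀ y ∈ closedBall w R, u y ≤ M := by
  obtain ⟨a, ha, hm⟩ := UpperSemicontinuousOn.exists_isMaxOn (s := closedBall w R)
    ⟨w, by simpa using hR⟩ (isCompact_closedBall w R) (hu.1.upperSemicontinuousOn _)
  refine ⟨max 0 (u a).toReal, le_max_left _ _, fun y hy => (hm hy).trans ?_⟩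
  refine (EReal.le_coe_toReal (hu.2.1 a).ne).trans ?_
  exact_mod_cast le_max_right _ _

/-- circle estimate -/
theorem circle_est (u : ℂ → EReal) (hu : SubharmonicFn u) (w : ℂ) (hw : u w ≠ ⊥) (R M : ℝ)
    (hM0 : 0 ≤ M) (hM : ∀ y ∈ closedBall w R, u y ≤ M) (n : ℕ) (r : ℝ) (hr : 0 < r) (hrR : r ≤ R) :
    ∫⁻ θ in Ioo (-π) π, ENNReal.ofReal (M - (max (u (w + r * Complex.exp (θ * Complex.I)))
      ((-(n : ℝ) : ℝ) : EReal)).toReal) ≤ ENNReal.ofReal (2 * π * (M - (u w).toReal)) := by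
  set f : ℝ → ℝ := fun θ => (max (u (w + r * Complex.exp (θ * Complex.I)))
      ((-(n : ℝ) : ℝ) : EReal)).toReal with hf
  have hmeas : Measurable f := by
    have : Measurable u := hu.1.measurable
    have h2 : Measurable fun θ : ℝ => (w + r * Complex.exp (θ * Complex.I)) := by fun_prop
    exact ((this.comp h2).max measurable_const).ereal_toReal
  have hle : ∀ θ, f θ ≤ M := by
    intro θ
    have : max (u (w + r * Complex.exp (θ * Complex.I))) ((-(n : ℝ) : ℝ) : EReal) ≤ (M : EReal) := by
      refine max_le (hM _ ?_) ?_
      · simp [Complex.norm_exp_ofReal_mul_I, abs_of_pos hr, hrR]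
      · exact_mod_cast (neg_nonpos.2 (Nat.cast_nonneg n)).trans hM0
    have h3 := EReal.toReal_le_toReal this (ne_of_gt (lt_of_lt_of_le (EReal.bot_lt_coe _) (le_max_right _ _))) (EReal.coe_ne_top _)
    rw [EReal.toReal_coe] at h3
    exact h3
  have hge : ∀ θ, -(n:ℝ) ≤ f θ := by
    intro θ
    have h3 := EReal.toReal_le_toReal (le_max_right (u (w + r * Complex.exp (θ * Complex.I))) ((-(n : ℝ) : ℝ) : EReal))
      (EReal.coe_ne_bot _) (max_lt (hu.2.1 _) (EReal.coe_lt_top _)).ne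
    rw [EReal.toReal_coe] at h3
    exact h3
  have hint : ∀ a b : ℝ, IntegrableOn f (Ioo a b) := by
    intro a b
    refine Measure.integrableOn_of_bounded (M := M + n) (by simp) hmeas.aestronglyMeasurable (ae_of_all _ fun θ => ?_)
    rw [Real.norm_eq_abs, abs_le]
    have : (0:ℝ) ≤ n := Nat.cast_nonneg n
    constructor <;> linarith [hle θ, hge θ]
  have hgi : IntegrableOn (fun θ => M - f θ) (Ioo (-π) π) :=
    (integrableOn_const (by simp)).sub (hint _ _)
  rw [← ofReal_integral_eq_lintegral_ofReal hgi (ae_of_all _ fun θ => sub_nonneg.2 (hle θ))]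
  apply ENNReal.ofReal_le_ofReal
  have hMi : Integrable (fun _ : ℝ => M) (volume.restrict (Ioo (-π) π)) :=
    integrableOn_const (by simp)
  rw [integral_sub hMi (hint _ _)]
  have hsub := hu.2.2 w r hr n
  have hper : Function.Periodic f (2 * π) := by
    intro θ
    simp only [hf]
    congr 5
    push_cast
    rw [add_mul, Complex.exp_periodic _]
  have e := hper.intervalIntegral_add_eq 0 (-π)
  rw [zero_add, show -π + 2 * π = π by ring] at e
  rw [e] at hsub
  rw [intervalIntegral.integral_of_le (by linarith [pi_pos]), integral_Ioc_eq_integral_Ioo] at hsub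
  have h4 := EReal.toReal_le_toReal hsub hw (EReal.coe_ne_top _)
  rw [EReal.toReal_coe] at h4
  have h5 : (2 * π) * (u w).toReal ≤ ∫ θ in Ioo (-π) π, f θ := by
    have := mul_le_mul_of_nonneg_left h4 (show 0 ≤ 2 * π by positivity)
    rwa [← mul_assoc, mul_inv_cancel₀ (by positivity), one_mul] at this
  have h6 : ∫ θ in Ioo (-π) π, M = 2 * π * M := by
    simp [Measure.real, pi_pos.le]
    left; ring
  rw [h6]; linarith

theorem disc_est (u : ℂ → EReal) (hu : SubharmonicFn u) (w : ℂ) (hw : u w ≠ ⊥) (R M : ℝ)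
    (hM0 : 0 ≤ M) (hM : ∀ y ∈ closedBall w R, u y ≤ M) (n : ℕ) :
    ∫⁻ y in ball w R, ENNReal.ofReal (M - (max (u y) ((-(n : ℝ) : ℝ) : EReal)).toReal)
      ≤ ENNReal.ofReal R * (ENNReal.ofReal R * ENNReal.ofReal (2 * π * (M - (u w).toReal))) := by
  set g : ℂ → ℝ≥0∞ := fun y => ENNReal.ofReal (M - (max (u y) ((-(n : ℝ) : ℝ) : EReal)).toReal)
  have hg : Measurable g :=
    (measurable_const.sub (hu.1.measurable.max measurable_const).ereal_toReal).ennreal_ofReal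
  rw [← lintegral_indicator measurableSet_ball,
    ← lintegral_add_left_eq_self (μ := volume) ((ball w R).indicator g) w,
    ← Complex.lintegral_comp_polarCoord_symm]
  rw [polarCoord_target, Measure.volume_eq_prod, ← Measure.prod_restrict]
  refine (lintegral_prod_le _).trans ?_
  calc _ ≤ ∫⁻ r in Ioi (0:ℝ), (Ioo 0 R).indicator
          (fun _ => ENNReal.ofReal R * ENNReal.ofReal (2 * π * (M - (u w).toReal))) r := by
        refine setLIntegral_mono' measurableSet_Ioi fun r hr => ?_
        have hr : 0 < r := hr
        by_cases hR : r < R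
        · rw [indicator_of_mem (show r ∈ Ioo 0 R from ⟨hr, hR⟩)]
          simp only [smul_eq_mul]
          rw [lintegral_const_mul' _ _ ENNReal.ofReal_ne_top]
          refine mul_le_mul' (ENNReal.ofReal_le_ofReal hR.le) ?_
          refine le_trans (lintegral_mono fun θ => ?_) (circle_est u hu w hw R M hM0 hM n r hr hR.le)
          refine (indicator_le_self _ _ _).trans ?_
          simp only [g]
          rw [Complex.polarCoord_symm_apply, Complex.exp_mul_I]
          push_cast
          rfl
        · rw [indicator_of_notMem (fun h => hR h.2)]
          refine (lintegral_eq_zero_of_ae_eq_zero (ae_of_all _ fun θ => ?_)).le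
          rw [indicator_of_notMem]
          · simp
          · simp only [mem_ball, dist_self_add_left, Complex.norm_polarCoord_symm, abs_of_pos hr]
            exact hR
    _ ≤ _ := by
        refine (setLIntegral_le_lintegral _ _).trans ?_
        rw [lintegral_indicator measurableSet_Ioo]
        simp [mul_comm]

theorem loc_int (u : ℂ → EReal) (hu : SubharmonicFn u) (w : ℂ) (hw : u w ≠ ⊥) (R : ℝ) (hR : 0 ≤ R) :
    (∀ᵐ y ∂(volume.restrict (ball w R)), u y ≠ ⊥) ∧
      IntegrableOn (fun y => (u y).toReal) (ball w R) := by
  obtain ⟨M, hM0, hM⟩ := bdd_above u hu w R hR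
  set g : ℕ → ℂ → ℝ≥0∞ := fun n y => ENNReal.ofReal (M - (max (u y) ((-(n : ℝ) : ℝ) : EReal)).toReal) with hgdef
  have hg : ∀ n, Measurable (g n) := fun n =>
    (measurable_const.sub (hu.1.measurable.max measurable_const).ereal_toReal).ennreal_ofReal
  have hmono : Monotone g := by
    intro m n hmn y
    apply ENNReal.ofReal_le_ofReal
    have : (max (u y) ((-(n : ℝ) : ℝ) : EReal)) ≤ (max (u y) ((-(m : ℝ) : ℝ) : EReal)) := by
      refine max_le_max le_rfl ?_
      exact_mod_cast neg_le_neg (Nat.cast_le.2 hmn)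
    have := EReal.toReal_le_toReal this
      (ne_of_gt (lt_of_lt_of_le (EReal.bot_lt_coe _) (le_max_right _ _)))
      (max_lt (hu.2.1 _) (EReal.coe_lt_top _)).ne
    linarith
  have hfin : ∫⁻ y in ball w R, ⨆ n, g n y < ⊤ := by
    rw [lintegral_iSup hg hmono]
    refine (iSup_le fun n => disc_est u hu w hw R M hM0 hM n).trans_lt ?_
    exact ENNReal.mul_lt_top ENNReal.ofReal_lt_top (ENNReal.mul_lt_top ENNReal.ofReal_lt_top ENNReal.ofReal_lt_top)
  have hbot : ∀ᵐ y ∂(volume.restrict (ball w R)), u y ≠ ⊥ := by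
    filter_upwards [ae_lt_top (Measurable.iSup hg) hfin.ne] with y hy hb
    refine hy.ne ?_
    rw [iSup_eq_top]
    intro b hbb
    obtain ⟨n, hn⟩ := exists_nat_gt b.toReal
    refine ⟨n, ?_⟩
    simp only [hgdef, hb]
    rw [max_eq_right bot_le, EReal.toReal_coe, ENNReal.lt_ofReal_iff_toReal_lt hbb.ne]
    linarith
  refine ⟨hbot, hu.1.measurable.ereal_toReal.aestronglyMeasurable, ?_⟩
  rw [hasFiniteIntegral_iff_enorm]
  calc _ ≤ ∫⁻ y in ball w R, (ENNReal.ofReal (2 * M) + ⨆ n, g n y) := by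
        refine lintegral_mono_ae ?_
        filter_upwards [hbot, ae_restrict_mem measurableSet_ball] with y hy hyb
        have h1 : (u y).toReal ≤ M := by
          have := EReal.toReal_le_toReal (hM y (ball_subset_closedBall hyb)) hy (EReal.coe_ne_top _)
          simpa using this
        obtain ⟨n, hn⟩ := exists_nat_gt (-(u y).toReal)
        refine le_trans ?_ (add_le_add le_rfl (le_iSup (fun n => g n y) n))
        have h2 : max (u y) ((-(n : ℝ) : ℝ) : EReal) = u y := by
          refine max_eq_left ?_
          rw [← EReal.coe_toReal (hu.2.1 y).ne hy]
          exact_mod_cast (by linarith : -(n:ℝ) ≤ (u y).toReal)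
        simp only [hgdef, h2]
        rw [← ENNReal.ofReal_add (by linarith) (by linarith), Real.enorm_eq_ofReal_abs]
        refine ENNReal.ofReal_le_ofReal ?_
        rw [abs_le]; constructor <;> linarith
    _ < ⊤ := by
        rw [lintegral_add_left measurable_const]
        simp only [lintegral_const, Measure.restrict_apply_univ]
        exact ENNReal.add_lt_top.2 ⟨ENNReal.mul_lt_top ENNReal.ofReal_lt_top measure_ball_lt_top, hfin⟩


theorem test_props (T T1 T2 : ℝ → ℝ) (hT : ∀ x, HasDerivAt T (T1 x) x)
    (hT1 : ∀ x, HasDerivAt T1 (T2 x) x) (hTc : ContDiff ℝ 2 T) (hTz : ∀ x, x ≤ 0 → T x = 0)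
    (z : ℂ) (ρ : ℝ) (hρ : 0 < ρ) (ε : ℝ) (hε : 0 < ε) :
    ContDiff ℝ 2 (fun y : ℂ => T (Real.log (ρ ^ 2) - Real.log (Complex.normSq (y - z) + ε))) ∧
    HasCompactSupport (fun y : ℂ => T (Real.log (ρ ^ 2) - Real.log (Complex.normSq (y - z) + ε))) ∧
    ∀ y, lap (fun y : ℂ => T (Real.log (ρ ^ 2) - Real.log (Complex.normSq (y - z) + ε))) y =
      4 * (-(ε / (Complex.normSq (y - z) + ε) ^ 2) *
          T1 (Real.log (ρ ^ 2) - Real.log (Complex.normSq (y - z) + ε)) +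
        Complex.normSq (y - z) / (Complex.normSq (y - z) + ε) ^ 2 *
          T2 (Real.log (ρ ^ 2) - Real.log (Complex.normSq (y - z) + ε))) := by
  refine ⟨?_, ?_, ?_⟩
  · refine hTc.comp (contDiff_const.sub (ContDiff.log ?_ fun y => ?_))
    · have : (fun y : ℂ => Complex.normSq (y - z) + ε) =
        fun y : ℂ => Complex.reCLM (y - z) * Complex.reCLM (y - z) +
          Complex.imCLM (y - z) * Complex.imCLM (y - z) + ε := by
        funext y; rw [Complex.normSq_apply]; rfl
      rw [this]
      fun_prop
    · have := Complex.normSq_nonneg (y - z); positivity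
  · refine HasCompactSupport.of_support_subset_isCompact (isCompact_closedBall z ρ) ?_
    intro y hy
    by_contra h
    apply hy
    rw [mem_closedBall, not_le, dist_eq_norm] at h
    have hs : ρ ^ 2 < Complex.normSq (y - z) := by
      rw [Complex.normSq_eq_norm_sq]; gcongr
    refine hTz _ ?_
    rw [sub_nonpos]; exact Real.log_le_log (by positivity) (by linarith)
  · intro y
    have hL : ∀ s, 0 ≤ s → HasDerivAt (fun s => Real.log (ρ ^ 2) - Real.log (s + ε)) (-(1 / (s + ε))) s := by
      intro s hs
      exact (((hasDerivAt_id s).add_const ε).log (by simp; positivity)).const_sub _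
    have hi : ∀ s, 0 ≤ s → HasDerivAt (fun s => -(1 / (s + ε))) (1 / (s + ε) ^ 2) s := by
      intro s hs
      have := (((hasDerivAt_id s).add_const ε).inv (by simp; positivity)).neg
      simp only [id] at this
      have e1 : (fun s => -(1 / (s + ε))) = -(fun x => x + ε)⁻¹ := by
        funext s; simp
      have e2 : 1 / (s + ε) ^ 2 = -(-1 / (s + ε) ^ 2) := by ring
      rw [e1, e2]
      exact this
    have hn := Complex.normSq_nonneg (y - z)
    rw [lap_radial (fun s => T (Real.log (ρ ^ 2) - Real.log (s + ε)))
      (fun s => T1 (Real.log (ρ ^ 2) - Real.log (s + ε)) * (-(1 / (s + ε))))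
      (fun s => T2 (Real.log (ρ ^ 2) - Real.log (s + ε)) * (-(1 / (s + ε))) * (-(1 / (s + ε))) +
        T1 (Real.log (ρ ^ 2) - Real.log (s + ε)) * (1 / (s + ε) ^ 2)) z y
      (fun s hs => (hT _).comp s (hL s hs))
      (fun s hs => ((hT1 _).comp s (hL s hs)).mul (hi s hs))]
    have : Complex.normSq (y - z) + ε ≠ 0 := by positivity
    field_simp
    ring

theorem upper_est (T : ℝ → ℝ) (hTc : ContDiff ℝ 2 T) (hTz : ∀ x, x ≤ 0 → T x = 0)
    (hTnn : ∀ x, 0 ≤ T x) (hTle : ∀ x, 0 ≤ x → T x ≤ x)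
    (z : ℂ) (ρ : ℝ) (hρ : 0 < ρ) (ε : ℝ) (hε : 0 < ε) (μ : Measure ℂ) [IsLocallyFiniteMeasure μ]
    (hφc : ContDiff ℝ 2 (fun y : ℂ => T (Real.log (ρ ^ 2) - Real.log (Complex.normSq (y - z) + ε))))
    (hφs : HasCompactSupport (fun y : ℂ => T (Real.log (ρ ^ 2) - Real.log (Complex.normSq (y - z) + ε))))
    (hJ : ∫⁻ t in Set.Ioc (0 : ℝ) ρ, μ (Metric.closedBall z t) / ENNReal.ofReal t < ⊤) :
    ∫ y, T (Real.log (ρ ^ 2) - Real.log (Complex.normSq (y - z) + ε)) ∂μ ≤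
      (2 * ∫⁻ t in Set.Ioc (0 : ℝ) ρ, μ (Metric.closedBall z t) / ENNReal.ofReal t).toReal := by
  have hφi := hφc.continuous.integrable_of_hasCompactSupport (μ := μ) hφs
  rw [← ENNReal.ofReal_le_iff_le_toReal (ENNReal.mul_lt_top (by simp) hJ).ne,
    ofReal_integral_eq_lintegral_ofReal hφi (ae_of_all _ fun y => hTnn _)]
  set k : ℂ → ℝ → ℝ≥0∞ := fun y t => {p : ℂ × ℝ | dist p.1 z ≤ p.2}.indicator
    (fun p => (ENNReal.ofReal p.2)⁻¹) (y, t) with hk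
  have hkm : Measurable (Function.uncurry k) := by
    have hS : MeasurableSet {p : ℂ × ℝ | dist p.1 z ≤ p.2} :=
      (isClosed_le (by fun_prop) (by fun_prop)).measurableSet
    have : Function.uncurry k = {p : ℂ × ℝ | dist p.1 z ≤ p.2}.indicator
      (fun p => (ENNReal.ofReal p.2)⁻¹) := rfl
    rw [this]
    exact (measurable_snd.ennreal_ofReal.inv).indicator hS
  have hpt : ∀ y, ENNReal.ofReal (T (Real.log (ρ ^ 2) - Real.log (Complex.normSq (y - z) + ε))) ≤
      2 * ∫⁻ t in Ioc 0 ρ, k y t := by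
    intro y
    have hn := Complex.normSq_nonneg (y - z)
    set a := Real.sqrt (Complex.normSq (y - z) + ε) with ha
    have ha0 : 0 < a := Real.sqrt_pos.2 (by linarith)
    have ha2 : Complex.normSq (y - z) + ε = a ^ 2 := (Real.sq_sqrt (by linarith)).symm
    have hda : dist y z ≤ a := by
      refine Real.le_sqrt_of_sq_le ?_
      rw [dist_eq_norm, ← Complex.normSq_eq_norm_sq]; linarith
    rw [ha2]
    by_cases haρ : ρ ≤ a
    · rw [hTz]
      · simp
      · rw [sub_nonpos]; exact Real.log_le_log (by positivity) (by gcongr)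
    push Not at haρ
    have h0 : 0 ≤ Real.log (ρ ^ 2) - Real.log (a ^ 2) := by
      rw [sub_nonneg]; exact Real.log_le_log (by positivity) (by gcongr)
    have hlog : Real.log (ρ ^ 2) - Real.log (a ^ 2) = 2 * ∫ t in a..ρ, t⁻¹ := by
      rw [integral_inv_of_pos ha0 hρ, Real.log_div hρ.ne' ha0.ne', Real.log_pow, Real.log_pow]
      push_cast; ring
    refine (ENNReal.ofReal_le_ofReal (hTle _ h0)).trans ?_
    rw [hlog, ENNReal.ofReal_mul (by norm_num), show ENNReal.ofReal 2 = 2 by simp]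
    refine mul_le_mul' le_rfl ?_
    have hii : IntervalIntegrable (fun t : ℝ => t⁻¹) volume a ρ := by
      refine intervalIntegral.intervalIntegrable_inv (fun t ht => ?_) continuousOn_id
      rw [uIcc_of_le haρ.le] at ht
      exact (ha0.trans_le ht.1).ne'
    rw [intervalIntegrable_iff_integrableOn_Ioc_of_le haρ.le] at hii
    rw [intervalIntegral.integral_of_le haρ.le, ofReal_integral_eq_lintegral_ofReal hii]
    · calc _ ≤ ∫⁻ t in Ioc a ρ, k y t := by
            refine setLIntegral_mono' measurableSet_Ioc fun t ht => ?_
            rw [hk]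
            simp only
            rw [indicator_of_mem (show (y, t) ∈ {p : ℂ × ℝ | dist p.1 z ≤ p.2} from hda.trans ht.1.le)]
            rw [ENNReal.ofReal_inv_of_pos (ha0.trans ht.1)]
        _ ≤ _ := lintegral_mono_set (Ioc_subset_Ioc_left ha0.le)
    · refine (ae_restrict_iff' measurableSet_Ioc).2 (ae_of_all _ fun t ht => ?_)
      exact inv_nonneg.2 (ha0.trans ht.1).le
  refine (lintegral_mono hpt).trans ?_
  rw [lintegral_const_mul' _ _ (by simp)]
  refine mul_le_mul' le_rfl ?_
  rw [lintegral_lintegral_swap hkm.aemeasurable]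
  refine lintegral_mono fun t => ?_
  have : (fun y => k y t) = (closedBall z t).indicator fun _ => (ENNReal.ofReal t)⁻¹ := by
    funext y
    by_cases h : dist y z ≤ t <;> simp [hk, indicator, h]
  rw [this, lintegral_indicator measurableSet_closedBall]
  simp [div_eq_mul_inv, mul_comm]


/-- if `u ≢ -∞` is subharmonic on `ℂ` with Riesz measure `μ` and
`u(z) = -∞`, then `∫₀^ρ μ(D̄(z,t))/t dt = +∞` for every `ρ > 0`. -/
theorem stmt8 (u : ℂ → EReal) (hu : SubharmonicFn u) (hne : ∃ w, u w ≠ ⊥)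
    (μ : Measure ℂ) [IsLocallyFiniteMeasure μ] (hμ : IsRieszMeasure u μ)
    (z : ℂ) (hz : u z = ⊥) (ρ : ℝ) (hρ : 0 < ρ) :
    ∫⁻ t in Set.Ioc (0 : ℝ) ρ, μ (Metric.closedBall z t) / ENNReal.ofReal t = ⊤ := by
  by_contra hJ
  obtain ⟨T, T1, T2, C, hT, hT1, hTc, hT1nn, hT1le, hT1one, hT1zero, hT2one, hT2zero, hT2C, hTz, hTnn, hTle⟩ :=
    exists_T
  have hC0 : 0 ≤ C := (abs_nonneg _).trans (hT2C 0)
  obtain ⟨w0, hw0⟩ := hne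
  set J := ∫⁻ t in Set.Ioc (0 : ℝ) ρ, μ (Metric.closedBall z t) / ENNReal.ofReal t with hJdef
  have hsubset : closedBall z ρ ⊆ ball w0 (dist z w0 + ρ + 1) := by
    intro y hy
    have := dist_triangle y z w0
    rw [mem_closedBall] at hy
    rw [mem_ball]; linarith
  obtain ⟨hae, hint⟩ := loc_int u hu w0 hw0 (dist z w0 + ρ + 1) (by positivity)
  have hint : IntegrableOn (fun y => (u y).toReal) (closedBall z ρ) := hint.mono_set hsubset
  have hae : ∀ᵐ y ∂(volume.restrict (closedBall z ρ)), u y ≠ ⊥ :=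
    ae_restrict_of_ae_restrict_of_subset hsubset hae
  have hae : ∀ᵐ y, y ∈ closedBall z ρ → u y ≠ ⊥ := (ae_restrict_iff' measurableSet_closedBall).1 hae
  set I := ∫ y in closedBall z ρ, |(u y).toReal| with hI
  have hI0 : 0 ≤ I := integral_nonneg fun y => abs_nonneg _
  set c := Real.log (ρ ^ 2) with hc
  have hec : Real.exp c = ρ ^ 2 := Real.exp_log (by positivity)
  set κ := Real.exp (c - 1) with hκ
  have hκ0 : 0 < κ := Real.exp_pos _
  set Cb := 4 * C / κ with hCb
  have hCb0 : 0 ≤ Cb := by positivity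
  obtain ⟨N, hN⟩ := exists_nat_gt ((2 * π * (2 * J).toReal + (1 + Cb) * I) / π)
  rw [div_lt_iff₀ pi_pos] at hN
  have hopen : IsOpen {y | u y < ((-(N:ℝ) : ℝ) : EReal)} := hu.1.isOpen_preimage _
  obtain ⟨δ, hδ, hball⟩ := Metric.isOpen_iff.1 hopen z (by
    show u z < _
    rw [hz]; exact EReal.bot_lt_coe _)
  obtain ⟨ε, hε, hεδ, hεκ, hεδ4⟩ : ∃ ε : ℝ, 0 < ε ∧ ε ≤ δ ^ 2 ∧ ε ≤ κ / 2 ∧ 4 * ε ≤ δ ^ 4 := by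
    refine ⟨min (δ ^ 2) (min (κ / 2) (δ ^ 4 / 4)), by positivity, min_le_left _ _,
      (min_le_right _ _).trans (min_le_left _ _), ?_⟩
    have : min (δ ^ 2) (min (κ / 2) (δ ^ 4 / 4)) ≤ δ ^ 4 / 4 := (min_le_right _ _).trans (min_le_right _ _)
    linarith
  set φ : ℂ → ℝ := fun y => T (c - Real.log (Complex.normSq (y - z) + ε)) with hφ
  obtain ⟨hφc, hφs, hφl⟩ := test_props T T1 T2 hT hT1 hTc hTz z ρ hρ ε hε
  have hup : ∫ y, φ y ∂μ ≤ (2 * J).toReal :=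
    upper_est T hTc hTz hTnn hTle z ρ hρ ε hε μ hφc hφs (lt_top_iff_ne_top.2 hJ)
  have hR := hμ φ hφc hφs
  have hlow : N * π - (1 + Cb) * I ≤ ∫ y, (u y).toReal * lap φ y := by
    have hlapc : Continuous (lap φ) := by
      have h2 : Continuous (iteratedFDeriv ℝ 2 φ) := hφc.continuous_iteratedFDeriv le_rfl
      unfold lap
      fun_prop
    have hlap0 : ∀ y, y ∉ closedBall z ρ → lap φ y = 0 := by
      intro y hy
      rw [mem_closedBall, not_le, dist_eq_norm] at hy
      have hs : ρ ^ 2 < Complex.normSq (y - z) := by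
        rw [Complex.normSq_eq_norm_sq]; gcongr
      have hL : c - Real.log (Complex.normSq (y - z) + ε) < 0 := by
        rw [sub_neg]; exact Real.log_lt_log (by positivity) (by linarith)
      rw [hφl, hT1zero _ hL, hT2zero _ hL]; simp
    have hfi : Integrable (fun y => (u y).toReal * lap φ y) := by
      obtain ⟨K, hK⟩ := (isCompact_closedBall z ρ).exists_bound_of_continuousOn hlapc.continuousOn
      have h1 : IntegrableOn (fun y => (u y).toReal * lap φ y) (closedBall z ρ) := by
        refine Integrable.mul_bdd (c := K) hint hlapc.aestronglyMeasurable ?_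
        exact (ae_restrict_iff' measurableSet_closedBall).2 (ae_of_all _ hK)
      refine (integrableOn_iff_integrable_of_support_subset ?_).1 h1
      intro y hy
      by_contra h
      exact hy (by simp [hlap0 y h])
    set g1 : ℂ → ℝ := (ball z (Real.sqrt ε)).indicator fun _ => N / ε with hg1
    set g2 : ℂ → ℝ := (closedBall z ρ).indicator fun y => (1 + Cb) * |(u y).toReal| with hg2
    have hg1i : Integrable g1 :=
      (integrable_indicator_iff measurableSet_ball).2 (integrableOn_const measure_ball_lt_top.ne)
    have hg2i : Integrable g2 :=
      (integrable_indicator_iff measurableSet_closedBall).2 (hint.abs.const_mul _)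
    have e1 : ∫ y, g1 y = N * π := by
      rw [hg1, integral_indicator measurableSet_ball, setIntegral_const]
      simp only [Measure.real, Complex.volume_ball, smul_eq_mul, ENNReal.toReal_mul, ENNReal.toReal_pow,
        ENNReal.toReal_ofReal (Real.sqrt_nonneg ε), Real.sq_sqrt hε.le, ENNReal.coe_toReal, NNReal.coe_real_pi]
      field_simp
    have e2 : ∫ y, g2 y = (1 + Cb) * I := by
      rw [hg2, integral_indicator measurableSet_closedBall, integral_const_mul]
    rw [← e1, ← e2, ← integral_sub hg1i hg2i]
    refine integral_mono_ae (hg1i.sub hg2i) hfi ?_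
    filter_upwards [hae] with y hy
    have hsd : Complex.normSq (y - z) = dist y z ^ 2 := by
      rw [Complex.normSq_eq_norm_sq, dist_eq_norm]
    have hs0 := Complex.normSq_nonneg (y - z)
    show g1 y - g2 y ≤ (u y).toReal * lap φ y
    have hneg : dist y z < δ → u y ≠ ⊥ → (u y).toReal ≤ -N := by
      intro hd hb
      have h1 : u y < ((-(N:ℝ) : ℝ) : EReal) := hball (mem_ball.2 hd)
      have := EReal.toReal_le_toReal h1.le hb (EReal.coe_ne_top _)
      rwa [EReal.toReal_coe] at this
    have hNN : (0:ℝ) ≤ N := Nat.cast_nonneg N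
    have hκρ : κ ≤ ρ ^ 2 := by
      rw [← hec]; exact Real.exp_le_exp.2 (by linarith)
    by_cases hb : y ∈ closedBall z ρ
    swap
    · have hnot : y ∉ ball z (Real.sqrt ε) := by
        intro h
        apply hb
        rw [mem_ball] at h
        rw [mem_closedBall]
        refine h.le.trans ?_
        rw [Real.sqrt_le_left hρ.le]
        linarith
      rw [hlap0 y hb, hg1, hg2, indicator_of_notMem hb, indicator_of_notMem hnot]; simp
    have hyb := hy hb
    rw [hg2, indicator_of_mem hb, hφl]
    set s := Complex.normSq (y - z) with hs
    set L := c - Real.log (s + ε) with hL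
    have hse : 0 < s + ε := by linarith
    by_cases hin : y ∈ ball z (Real.sqrt ε)
    · rw [hg1, indicator_of_mem hin]
      rw [mem_ball] at hin
      have hsε : s < ε := by
        rw [hsd, ← Real.sq_sqrt hε.le]; gcongr
      have hL1 : 1 < L := by
        have : Real.log (s + ε) < c - 1 := by
          rw [Real.log_lt_iff_lt_exp hse]; linarith
        linarith
      have hu1 := hneg (hin.trans_le ((Real.sqrt_le_left hδ.le).2 hεδ)) hyb
      rw [hT1one _ hL1, hT2one _ hL1]
      have hk : 1 / ε ≤ 4 * (ε / (s + ε) ^ 2) := by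
        rw [← mul_div_assoc, div_le_div_iff₀ hε (by positivity)]
        nlinarith
      have h3 : N / ε ≤ -(u y).toReal * (4 * (ε / (s + ε) ^ 2)) := by
        calc N / ε = N * (1 / ε) := by ring
          _ ≤ _ := mul_le_mul (by linarith) hk (by positivity) (by linarith)
      have h4 : 0 ≤ (1 + Cb) * |(u y).toReal| := by positivity
      have h5 : (u y).toReal * (4 * (-(ε / (s + ε) ^ 2) * 1 + s / (s + ε) ^ 2 * 0)) =
          -(u y).toReal * (4 * (ε / (s + ε) ^ 2)) := by ring
      linarith
    · rw [hg1, indicator_of_notMem hin]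
      have hA : -|(u y).toReal| ≤ -(u y).toReal * (4 * (ε / (s + ε) ^ 2) * T1 L) := by
        have hT1a := hT1nn L
        have hT1b := hT1le L
        have hk0 : 0 ≤ ε / (s + ε) ^ 2 := by positivity
        by_cases hd : dist y z < δ
        · have := hneg hd hyb
          have h6 : 0 ≤ -(u y).toReal * (4 * (ε / (s + ε) ^ 2) * T1 L) :=
            mul_nonneg (by linarith) (by positivity)
          linarith [abs_nonneg (u y).toReal]
        · have hsδ : δ ^ 2 ≤ s + ε := by
            have : δ ^ 2 ≤ s := by rw [hsd]; push Not at hd; gcongr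
            linarith
          have hk1 : 4 * (ε / (s + ε) ^ 2) ≤ 1 := by
            rw [← mul_div_assoc, div_le_one (by positivity)]
            calc 4 * ε ≤ δ ^ 4 := hεδ4
              _ = (δ ^ 2) ^ 2 := by ring
              _ ≤ _ := by gcongr
          have hk2 : 4 * (ε / (s + ε) ^ 2) * T1 L ≤ 1 := mul_le_one₀ hk1 hT1a hT1b
          have hk3 : 0 ≤ 4 * (ε / (s + ε) ^ 2) * T1 L := by positivity
          have : |(u y).toReal * (4 * (ε / (s + ε) ^ 2) * T1 L)| ≤ |(u y).toReal| := by
            rw [abs_mul, abs_of_nonneg hk3]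
            exact mul_le_of_le_one_right (abs_nonneg _) hk2
          have := (abs_le.1 this).2
          linarith
      have hB : -(Cb * |(u y).toReal|) ≤ (u y).toReal * (4 * (s / (s + ε) ^ 2 * T2 L)) := by
        have hk : |4 * (s / (s + ε) ^ 2 * T2 L)| ≤ Cb := by
          by_cases hL1 : 1 < L
          · rw [hT2one _ hL1]; simpa using hCb0
          · have hse2 : κ ≤ s + ε := by
              rw [hκ, ← Real.le_log_iff_exp_le hse]; linarith
            have h7 : s / (s + ε) ^ 2 ≤ 1 / κ := by
              rw [div_le_div_iff₀ (by positivity) hκ0]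
              nlinarith
            rw [abs_mul, abs_mul, abs_of_nonneg (show 0 ≤ s / (s + ε) ^ 2 by positivity), hCb,
              abs_of_pos (show (0:ℝ) < 4 by norm_num)]
            calc 4 * (s / (s + ε) ^ 2 * |T2 L|) ≤ 4 * (1 / κ * C) := by
                  have := hT2C L
                  gcongr
              _ = _ := by ring
        have : |(u y).toReal * (4 * (s / (s + ε) ^ 2 * T2 L))| ≤ Cb * |(u y).toReal| := by
          rw [abs_mul, mul_comm Cb]
          exact mul_le_mul_of_nonneg_left hk (abs_nonneg _)
        exact (abs_le.1 this).1
      have h5 : (u y).toReal * (4 * (-(ε / (s + ε) ^ 2) * T1 L + s / (s + ε) ^ 2 * T2 L)) =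
          -(u y).toReal * (4 * (ε / (s + ε) ^ 2) * T1 L) +
          (u y).toReal * (4 * (s / (s + ε) ^ 2 * T2 L)) := by ring
      rw [h5]
      linarith
  rw [hR] at hlow
  have := mul_le_mul_of_nonneg_left hup (show 0 ≤ 2 * π by positivity)
  linarith
end

section
/- Let μ be a positive Borel measure on ℂ, let p : ℂ → (0, ∞) be a bounded Borel function with s := sup_z p(z) < ∞, and let d ∈ (0, 2]. Define E := { z ∈ ℂ : ∫₀^{p(z)} μ_z(t)/t dt > 1/d }, where μ_z(t) := μ(D̄(z,t)). Then for every set S ⊆ ℂ there is a Borel set S_s contained in ∪_{z∈S} D̄(z, 2s) such that 𝔪_d^p(E ∩ S) ≤ 60 ∫_{S_s} (p^d)^{∨s} dμ, where (p^d)^{∨s}(z) := sup { p(w)^d : |w - z| ≤ s }. -/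
open MeasureTheory Metric Set ENNReal

/-- The `d`-dimensional Hausdorff content with variable covering radius `r`. -/
noncomputable def hausdorffContentVar (d : ℝ) (r : ℂ → ℝ≥0∞) (S : Set ℂ) : ℝ≥0∞ :=
  ⨅ (z : ℕ → ℂ) (ρ : ℕ → ℝ) (_ : ∀ k, 0 ≤ ρ k)
    (_ : ∀ k, ENNReal.ofReal (ρ k) ≤ r (z k))
    (_ : S ⊆ ⋃ k, Metric.closedBall (z k) (ρ k)),
    ∑' k, ENNReal.ofReal (Real.pi ^ (d / 2) / Real.Gamma (1 + d / 2) * ρ k ^ d)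

/-- Greedy (Besicovitch-type) selection. -/
theorem aux_select (A : Set ℂ) (r : ℂ → ℝ) (s : ℝ) (hr : ∀ z ∈ A, 0 < r z ∧ r z ≤ s) :
    ∃ T ⊆ A, (A ⊆ ⋃ z ∈ T, closedBall z (r z)) ∧
      ∀ z ∈ T, ∀ w ∈ T, z ≠ w →
        (r z ≤ dist z w ∧ r w ≤ (11/10) * r z) ∨ (r w ≤ dist w z ∧ r z ≤ (11/10) * r w) := by
  rcases A.eq_empty_or_nonempty with rfl | hne
  · exact ⟨∅, by simp, by simp, by simp⟩
  have : Nonempty A := hne.to_subtype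
  let q : Besicovitch.TauPackage A ℂ :=
    { c := fun a => a.1
      r := fun a => r a.1
      rpos := fun a => (hr a.1 a.2).1
      r_bound := s
      r_le := fun a => (hr a.1 a.2).2
      τ := 11/10
      one_lt_tau := by norm_num }
  have key : ∀ i < q.lastStep, q.c (q.index i) ∉ q.iUnionUpTo i ∧
      q.R i ≤ q.τ * q.r (q.index i) := by
    intro i hi
    have h : ∃ b : A, q.c b ∉ q.iUnionUpTo i ∧ q.R i ≤ q.τ * q.r b := by
      by_contra hcon
      exact notMem_of_lt_csInf hi (OrderBot.bddBelow _) hcon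
    have e : q.index i =
        Classical.epsilon fun b : A => q.c b ∉ q.iUnionUpTo i ∧ q.R i ≤ q.τ * q.r b := by
      rw [Besicovitch.TauPackage.index]; rfl
    rw [e]
    exact Classical.epsilon_spec h
  have pair : ∀ i j, i < j → j < q.lastStep →
      r (q.index i).1 ≤ dist (q.index i).1 (q.index j).1 ∧
      r (q.index j).1 ≤ (11/10) * r (q.index i).1 := by
    intro i j hij hj
    have hi := key i (hij.trans hj)
    have hj' := key j hj
    constructor
    · have h1 := hj'.1
      simp only [Besicovitch.TauPackage.iUnionUpTo, mem_iUnion, not_exists, Subtype.forall] at h1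
      have h2 := h1 i hij
      simp only [mem_ball, not_lt] at h2
      rw [dist_comm]
      exact h2
    · refine le_trans ?_ hi.2
      have hn : q.c (q.index j) ∉ q.iUnionUpTo i :=
        fun h => hj'.1 (q.monotone_iUnionUpTo hij.le h)
      have hb : BddAbove (range fun b : { b : A // q.c b ∉ q.iUnionUpTo i } => q.r b) := by
        refine ⟨s, ?_⟩
        rintro _ ⟨b, rfl⟩
        exact q.r_le b
      exact le_ciSup hb ⟨q.index j, hn⟩
  refine ⟨{z | ∃ i < q.lastStep, (q.index i).1 = z}, ?_, ?_, ?_⟩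
  · rintro z ⟨i, -, rfl⟩
    exact (q.index i).2
  · intro z hz
    have := q.mem_iUnionUpTo_lastStep ⟨z, hz⟩
    simp only [Besicovitch.TauPackage.iUnionUpTo, mem_iUnion] at this
    obtain ⟨⟨i, hi⟩, h⟩ := this
    simp only [mem_iUnion]
    exact ⟨(q.index i).1, ⟨i, hi, rfl⟩, ball_subset_closedBall h⟩
  · rintro z ⟨i, hi, rfl⟩ w ⟨j, hj, rfl⟩ hne
    rcases lt_trichotomy i j with h | h | h
    · exact Or.inl (pair i j h hj)
    · subst h; exact absurd rfl hne
    · exact Or.inr (pair j i h hi)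

/-- The octant of a complex number. -/
noncomputable def auxOct (u : ℂ) : Bool × Bool × Bool :=
  (decide (0 ≤ u.re), decide (0 ≤ u.im), decide (|u.im| ≤ |u.re|))

theorem aux_inner (u v : ℂ) (h : auxOct u = auxOct v) :
    7/10 * (‖u‖ * ‖v‖) ≤ u.re * v.re + u.im * v.im := by
  simp only [auxOct, Prod.mk.injEq, decide_eq_decide] at h
  obtain ⟨h1, h2, h3⟩ := h
  have e1 : u.re * v.re = |u.re| * |v.re| := by
    by_cases hu : 0 ≤ u.re
    · rw [abs_of_nonneg hu, abs_of_nonneg (h1.1 hu)]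
    · have hv : ¬ 0 ≤ v.re := fun hh => hu (h1.2 hh)
      push Not at hu hv
      rw [abs_of_neg hu, abs_of_neg hv]; ring
  have e2 : u.im * v.im = |u.im| * |v.im| := by
    by_cases hu : 0 ≤ u.im
    · rw [abs_of_nonneg hu, abs_of_nonneg (h2.1 hu)]
    · have hv : ¬ 0 ≤ v.im := fun hh => hu (h2.2 hh)
      push Not at hu hv
      rw [abs_of_neg hu, abs_of_neg hv]; ring
  have n1 : ‖u‖ ^ 2 = |u.re| ^ 2 + |u.im| ^ 2 := by
    rw [Complex.sq_norm, Complex.normSq_apply, sq_abs, sq_abs]; ring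
  have n2 : ‖v‖ ^ 2 = |v.re| ^ 2 + |v.im| ^ 2 := by
    rw [Complex.sq_norm, Complex.normSq_apply, sq_abs, sq_abs]; ring
  rw [e1, e2]
  have a0 := abs_nonneg u.re
  have b0 := abs_nonneg u.im
  have c0 := abs_nonneg v.re
  have d0 := abs_nonneg v.im
  generalize |u.re| = a at *
  generalize |u.im| = b at *
  generalize |v.re| = c at *
  generalize |v.im| = e at *
  have hprod : 0 ≤ (a^2 - b^2) * (c^2 - e^2) := by
    by_cases hh : b ≤ a
    · have := h3.1 hh
      exact mul_nonneg (by nlinarith) (by nlinarith)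
    · have h4 : ¬ e ≤ c := fun k => hh (h3.2 k)
      push Not at hh h4
      exact mul_nonneg_of_nonpos_of_nonpos (by nlinarith) (by nlinarith)
  have hx : 0 ≤ a * c + b * e := by positivity
  apply le_of_sq_le_sq _ hx
  have : (7/10 * (‖u‖ * ‖v‖))^2 = 49/100 * ((a^2+b^2) * (c^2+e^2)) := by
    rw [← n1, ← n2]; ring
  rw [this]
  have : 0 ≤ (a * c) * (b * e) := by positivity
  nlinarith [sq_nonneg (a*c+b*e)]

theorem aux_quad (A B r : ℝ) (hr : 0 < r) (hA : 2/5 * r ≤ A) (hA' : A ≤ r) (hB : 0 < B)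
    (hB' : B ≤ 11/10 * r) : A^2 + B^2 - 7/5 * (A * B) < r^2 := by
  have h1 : (A - 2/5*r) * (r - A) ≥ 0 := mul_nonneg (by linarith) (by linarith)
  have h2 : B * (11/10*r - B) ≥ 0 := mul_nonneg hB.le (by linarith)
  -- `A^2 ≤ (7/5) r A - (2/5) r^2`, `B^2 ≤ (11/10) r B`
  have h3 : A^2 + B^2 - 7/5 * (A*B) ≤ 7/5*r*A - 2/5*r^2 + 11/10*r*B - 7/5*(A*B) := by nlinarith
  have h4 : 7/5*r*A - 2/5*r^2 + 11/10*r*B - 7/5*(A*B) < r^2 := by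
    nlinarith [mul_nonneg (sub_nonneg.2 hA') (sub_nonneg.2 hB'), mul_pos hr hB, mul_pos hr hr,
      mul_nonneg (sub_nonneg.2 hA) (sub_nonneg.2 hB'), mul_nonneg (sub_nonneg.2 hA') hB.le,
      mul_nonneg (sub_nonneg.2 hA) hB.le]
  linarith

theorem aux_pair (x z w : ℂ) (a b : ℝ) (ha : 0 < a) (hb : 0 < b)
    (hz : dist x z ≤ a) (hw : dist x w ≤ b) (h1 : a ≤ dist z w) (h2 : b ≤ 11/10 * a)
    (hsz : 2/5 * a ≤ dist x z) (hsw : 2/5 * b ≤ dist x w)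
    (ho : auxOct (z - x) = auxOct (w - x)) : False := by
  have hi := aux_inner _ _ ho
  have nz : ‖z - x‖ = dist x z := by rw [dist_comm, Complex.dist_eq]
  have nw : ‖w - x‖ = dist x w := by rw [dist_comm, Complex.dist_eq]
  have e : dist z w ^ 2 = dist x z ^ 2 + dist x w ^ 2
      - 2 * ((z - x).re * (w - x).re + (z - x).im * (w - x).im) := by
    rw [← nz, ← nw, Complex.dist_eq, Complex.sq_norm, Complex.sq_norm, Complex.sq_norm,
      Complex.normSq_apply, Complex.normSq_apply, Complex.normSq_apply]
    simp only [Complex.sub_re, Complex.sub_im]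
    ring
  rw [nz, nw] at hi
  have := aux_quad (dist x z) (dist x w) a ha hsz hz (by linarith) (by linarith)
  nlinarith

theorem aux_overlap (T : Set ℂ) (r : ℂ → ℝ) (hr : ∀ z ∈ T, 0 < r z)
    (hT : ∀ z ∈ T, ∀ w ∈ T, z ≠ w →
        (r z ≤ dist z w ∧ r w ≤ (11/10) * r z) ∨ (r w ≤ dist w z ∧ r z ≤ (11/10) * r w))
    (x : ℂ) : {z ∈ T | x ∈ closedBall z (r z)}.encard ≤ 9 := by
  classical
  let σ : ℂ → Option (Bool × Bool × Bool) := fun z =>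
    if dist x z < 2/5 * r z then none else some (auxOct (z - x))
  have hinj : InjOn σ {z ∈ T | x ∈ closedBall z (r z)} := by
    rintro z ⟨hz, hxz⟩ w ⟨hw, hxw⟩ hσ
    by_contra hne
    rw [mem_closedBall] at hxz hxw
    have rz := hr z hz
    have rpw := hr w hw
    simp only [σ] at hσ
    split_ifs at hσ with h1 h2 h2
    · have t1 := dist_triangle_left z w x
      have t2 := dist_triangle_left w z x
      rcases hT z hz w hw hne with h | h
      · linarith
      · linarith
    · push Not at h1 h2
      have ho := Option.some.inj hσ
      rcases hT z hz w hw hne with h | h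
      · exact aux_pair x z w _ _ rz rpw hxz hxw h.1 h.2 h1 h2 ho
      · exact aux_pair x w z _ _ rpw rz hxw hxz h.1 h.2 h2 h1 ho.symm
  have := encard_le_encard_of_injOn (mapsTo_univ σ _) hinj
  refine this.trans ?_
  rw [encard_univ, ENat.card_eq_coe_fintype_card]
  simp

theorem aux_const (d : ℝ) (hd : d ∈ Set.Ioc (0 : ℝ) 2) :
    0 ≤ Real.pi ^ (d / 2) / Real.Gamma (1 + d / 2) ∧
    9 * (Real.pi ^ (d / 2) / Real.Gamma (1 + d / 2)) ≤ 60 := by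
  obtain ⟨h0, h2⟩ := hd
  have hpi : Real.pi ^ (d/2) ≤ Real.pi := by
    calc Real.pi ^ (d/2) ≤ Real.pi ^ (1:ℝ) :=
          Real.rpow_le_rpow_of_exponent_le (by linarith [Real.pi_gt_three]) (by linarith)
      _ = Real.pi := Real.rpow_one _
  have hG : 1 / 2 ≤ Real.Gamma (1 + d/2) := by
    have e := Real.Gamma_add_one (s := 1 + d/2) (by positivity)
    have m := Real.Gamma_strictMonoOn_Ici.monotoneOn (a := 2) (b := 1 + d/2 + 1)
      (by simp) (by simp only [mem_Ici]; linarith) (by linarith)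
    rw [Real.Gamma_two, e] at m
    have hpos : 0 < Real.Gamma (1 + d/2) := Real.Gamma_pos_of_pos (by positivity)
    nlinarith
  refine ⟨by positivity, ?_⟩
  rw [← mul_div_assoc, div_le_iff₀ (by linarith)]
  have := Real.pi_lt_d2
  linarith

theorem aux_radius (μ : Measure ℂ) (d : ℝ) (hd : 0 < d) (z : ℂ) (p : ℝ) (hp : 0 < p)
    (h : ENNReal.ofReal (1 / d) <
      ∫⁻ t in Set.Ioc (0 : ℝ) p, μ (Metric.closedBall z t) / ENNReal.ofReal t) :
    ∃ t, 0 < t ∧ t ≤ p ∧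
      ENNReal.ofReal (t ^ d) ≤ ENNReal.ofReal (p ^ d) * μ (closedBall z t) := by
  by_contra hcon
  push Not at hcon
  refine absurd h (not_lt.2 ?_)
  have hpd : 0 < p ^ d := Real.rpow_pos_of_pos hp d
  have hint : IntegrableOn (fun t : ℝ => (p^d)⁻¹ * t ^ (d - 1)) (Ioc 0 p) := by
    have := intervalIntegral.intervalIntegrable_rpow' (a := 0) (b := p) (r := d - 1) (by linarith)
    exact ((intervalIntegrable_iff_integrableOn_Ioc_of_le hp.le).1 this).const_mul _
  calc ∫⁻ t in Set.Ioc (0 : ℝ) p, μ (Metric.closedBall z t) / ENNReal.ofReal t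
      ≤ ∫⁻ t in Set.Ioc (0 : ℝ) p, ENNReal.ofReal ((p^d)⁻¹ * t ^ (d - 1)) := by
        refine setLIntegral_mono' measurableSet_Ioc ?_
        rintro t ⟨ht0, htp⟩
        have h1 := (hcon t ht0 htp).le
        have h2 : μ (closedBall z t) ≤ ENNReal.ofReal (t ^ d / p ^ d) := by
          rw [ENNReal.ofReal_div_of_pos hpd]
          rw [ENNReal.le_div_iff_mul_le (Or.inl (by simpa using hpd)) (Or.inl ENNReal.ofReal_ne_top),
            mul_comm]
          exact h1
        calc μ (closedBall z t) / ENNReal.ofReal t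
            ≤ ENNReal.ofReal (t ^ d / p ^ d) / ENNReal.ofReal t := by gcongr
          _ = ENNReal.ofReal ((p^d)⁻¹ * t ^ (d - 1)) := by
              rw [← ENNReal.ofReal_div_of_pos ht0, Real.rpow_sub_one ht0.ne']
              congr 1
              field_simp
    _ = ENNReal.ofReal (∫ t in Set.Ioc (0 : ℝ) p, (p^d)⁻¹ * t ^ (d - 1)) := by
        rw [ofReal_integral_eq_lintegral_ofReal hint]
        filter_upwards [ae_restrict_mem measurableSet_Ioc] with t ht
        have := Real.rpow_nonneg ht.1.le (d - 1)
        show (0:ℝ) ≤ _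
        positivity
    _ = ENNReal.ofReal (1 / d) := by
        congr 1
        rw [← intervalIntegral.integral_of_le hp.le, intervalIntegral.integral_const_mul,
          integral_rpow (Or.inl (by linarith))]
        rw [sub_add_cancel, Real.zero_rpow hd.ne', sub_zero]
        field_simp
    _ ≤ _ := le_rfl

/-- for a positive Borel measure `μ` on `ℂ`, a bounded Borel function
`p : ℂ → (0,∞)` with `s := sup p`, and `d ∈ (0,2]`, the exceptional set
`E := {z : ∫₀^{p(z)} μ_z(t)/t dt > 1/d}` satisfies, for every `S ⊆ ℂ`,
`𝔪_d^p(E ∩ S) ≤ 60 ∫_{S_s} (p^d)^{∨s} dμ` for some Borel set `S_s ⊆ ∪_{z∈S} D̄(z,2s)`. -/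
theorem stmt11 (μ : Measure ℂ) (p : ℂ → ℝ) (hp : ∀ z, 0 < p z)
    (hpm : Measurable p) (hbdd : BddAbove (Set.range p)) (d : ℝ) (hd : d ∈ Set.Ioc (0 : ℝ) 2)
    (E : Set ℂ)
    (hE : E = {z : ℂ | ENNReal.ofReal (1 / d) <
      ∫⁻ t in Set.Ioc (0 : ℝ) (p z), μ (Metric.closedBall z t) / ENNReal.ofReal t}) :
    ∀ S : Set ℂ, ∃ Ss : Set ℂ, MeasurableSet Ss ∧
      Ss ⊆ ⋃ z ∈ S, Metric.closedBall z (2 * sSup (Set.range p)) ∧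
      hausdorffContentVar d (fun z => ENNReal.ofReal (p z)) (E ∩ S) ≤
        60 * ∫⁻ z in Ss,
          ENNReal.ofReal (sSup ((fun w => p w ^ d) ''
            Metric.closedBall z (sSup (Set.range p)))) ∂μ := by
  classical
  intro S
  set s := sSup (Set.range p) with hs
  have hps : ∀ z, p z ≤ s := fun z => le_csSup hbdd (mem_range_self z)
  have hd0 : 0 < d := hd.1
  have hrad : ∀ z : ℂ, ∃ t, z ∈ E ∩ S → (0 < t ∧ t ≤ p z ∧
      ENNReal.ofReal (t ^ d) ≤ ENNReal.ofReal (p z ^ d) * μ (closedBall z t)) := by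
    intro z
    by_cases hz : z ∈ E ∩ S
    · have h := hz.1
      rw [hE] at h
      obtain ⟨t, ht⟩ := aux_radius μ d hd0 z (p z) (hp z) h
      exact ⟨t, fun _ => ht⟩
    · exact ⟨0, fun h => absurd h hz⟩
  choose r hr using hrad
  obtain ⟨T, hTA, hcov, hpair⟩ := aux_select (E ∩ S) r s
    (fun z hz => ⟨(hr z hz).1, (hr z hz).2.1.trans (hps z)⟩)
  have hrT : ∀ z ∈ T, 0 < r z := fun z hz => (hr z (hTA hz)).1
  have hov := aux_overlap T r hrT hpair
  -- countability
  have hcount : T.Countable := by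
    have hsub : T ⊆ ⋃ n : ℕ, {z ∈ T | TopologicalSpace.denseSeq ℂ n ∈ closedBall z (r z)} := by
      intro z hz
      obtain ⟨n, hn⟩ := (TopologicalSpace.denseRange_denseSeq ℂ).exists_mem_open
        (isOpen_ball (x := z) (ε := r z)) ⟨z, mem_ball_self (hrT z hz)⟩
      exact mem_iUnion.2 ⟨n, hz, ball_subset_closedBall hn⟩
    refine (countable_iUnion fun n => ?_).mono hsub
    refine (finite_of_encard_le_coe (k := 9) ?_).countable
    exact_mod_cast hov _
  have : Countable T := hcount.to_subtype
  refine ⟨⋃ z ∈ T, closedBall z (r z),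
    MeasurableSet.biUnion hcount fun z _ => isClosed_closedBall.measurableSet, ?_, ?_⟩
  · refine iUnion₂_subset fun z hz => ?_
    refine subset_trans ?_ (subset_biUnion_of_mem (hTA hz).2)
    apply closedBall_subset_closedBall
    have := (hr z (hTA hz)).2.1
    have := hps z
    have := hp z
    linarith
  set Ss := ⋃ z ∈ T, closedBall z (r z) with hSs
  have hSm : MeasurableSet Ss :=
    MeasurableSet.biUnion hcount fun z _ => isClosed_closedBall.measurableSet
  set G : ℂ → ℝ≥0∞ := fun z => ENNReal.ofReal (sSup ((fun w => p w ^ d) ''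
            Metric.closedBall z s)) with hG
  have hGle : ∀ z w, dist z w ≤ s → ENNReal.ofReal (p w ^ d) ≤ G z := by
    intro z w hzw
    apply ENNReal.ofReal_le_ofReal
    refine le_csSup ⟨s ^ d, ?_⟩ ⟨w, ?_, rfl⟩
    · rintro _ ⟨v, -, rfl⟩
      exact Real.rpow_le_rpow (hp v).le (hps v) hd0.le
    · rw [mem_closedBall, dist_comm]; exact hzw
  -- main integral estimate
  have hmain : ∑' z : T, ENNReal.ofReal (r z ^ d) ≤ 9 * ∫⁻ z in Ss, G z ∂μ := by
    calc ∑' z : T, ENNReal.ofReal (r z ^ d)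
        ≤ ∑' z : T, ∫⁻ x, (closedBall (z:ℂ) (r z)).indicator
            (fun _ => ENNReal.ofReal (p z ^ d)) x ∂μ := by
          refine ENNReal.tsum_le_tsum fun z => ?_
          rw [lintegral_indicator_const isClosed_closedBall.measurableSet]
          exact (hr z (hTA z.2)).2.2
      _ = ∫⁻ x, ∑' z : T, (closedBall (z:ℂ) (r z)).indicator
            (fun _ => ENNReal.ofReal (p z ^ d)) x ∂μ := by
          rw [lintegral_tsum]
          intro z
          exact (measurable_const.indicator isClosed_closedBall.measurableSet).aemeasurable
      _ ≤ ∫⁻ x, Ss.indicator (fun x => 9 * G x) x ∂μ := by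
          refine lintegral_mono fun x => ?_
          rw [ENNReal.tsum_eq_iSup_sum]
          refine iSup_le fun F => ?_
          by_cases hx : x ∈ Ss
          · rw [indicator_of_mem hx]
            simp only [indicator_apply]
            rw [← Finset.sum_filter]
            have hcard : ((F.filter fun z : T => x ∈ closedBall (z:ℂ) (r z)).card : ℕ∞) ≤ 9 := by
              refine le_trans ?_ (hov x)
              rw [← Finset.card_map (Function.Embedding.subtype (· ∈ T)),
                ← Set.encard_coe_eq_coe_finsetCard]
              apply encard_le_encard
              intro z hz
              simp only [Finset.coe_map, mem_image, Finset.mem_coe, Finset.mem_filter] at hz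
              obtain ⟨w, ⟨-, hw⟩, rfl⟩ := hz
              exact ⟨w.2, hw⟩
            have hcard' : (F.filter fun z : T => x ∈ closedBall (z:ℂ) (r z)).card ≤ 9 := by
              exact_mod_cast hcard
            refine (Finset.sum_le_card_nsmul _ _ (G x) ?_).trans ?_
            · intro z hz
              have hz' := (Finset.mem_filter.1 hz).2
              rw [mem_closedBall] at hz'
              exact hGle x z (hz'.trans ((hr z (hTA z.2)).2.1.trans (hps z)))
            · rw [nsmul_eq_mul]
              gcongr
              exact_mod_cast hcard'
          · rw [indicator_of_notMem hx]
            refine (Finset.sum_eq_zero fun z _ => ?_).le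
            apply indicator_of_notMem
            intro hxz
            exact hx (mem_biUnion z.2 hxz)
      _ = 9 * ∫⁻ z in Ss, G z ∂μ := by
          rw [lintegral_indicator hSm, lintegral_const_mul' _ _ (by norm_num)]
  -- the covering sequence
  obtain ⟨f, hf⟩ := exists_injective_nat T
  obtain ⟨hC0, hC⟩ := aux_const d hd
  set C := Real.pi ^ (d / 2) / Real.Gamma (1 + d / 2) with hCdef
  let zz : ℕ → ℂ := Function.extend f (fun z : T => (z:ℂ)) 0
  let ρ : ℕ → ℝ := Function.extend f (fun z : T => r z) 0
  have hzz : ∀ t : T, zz (f t) = t := fun t => hf.extend_apply _ _ t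
  have hρ : ∀ t : T, ρ (f t) = r t := fun t => hf.extend_apply _ _ t
  have hρ0 : ∀ k, (¬ ∃ t, f t = k) → ρ k = 0 := fun k hk => Function.extend_apply' _ _ _ hk
  have hle : hausdorffContentVar d (fun z => ENNReal.ofReal (p z)) (E ∩ S) ≤
      ∑' k, ENNReal.ofReal (C * ρ k ^ d) := by
    unfold hausdorffContentVar
    refine iInf_le_of_le zz (iInf_le_of_le ρ (iInf_le_of_le ?_ (iInf_le_of_le ?_
      (iInf_le_of_le ?_ le_rfl))))
    · intro k
      by_cases hk : ∃ t, f t = k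
      · obtain ⟨t, rfl⟩ := hk
        rw [hρ]; exact (hrT t t.2).le
      · rw [hρ0 k hk]
    · intro k
      by_cases hk : ∃ t, f t = k
      · obtain ⟨t, rfl⟩ := hk
        rw [hρ, hzz]
        exact ENNReal.ofReal_le_ofReal (hr t (hTA t.2)).2.1
      · rw [hρ0 k hk]; simp
    · intro z hz
      obtain ⟨w, hw, hzw⟩ := mem_iUnion₂.1 (hcov hz)
      refine mem_iUnion.2 ⟨f ⟨w, hw⟩, ?_⟩
      rw [hρ, hzz]; exact hzw
  have hsum : ∑' k, ENNReal.ofReal (C * ρ k ^ d) = ∑' z : T, ENNReal.ofReal (C * r z ^ d) := by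
    rw [← hf.tsum_eq (f := fun k => ENNReal.ofReal (C * ρ k ^ d))]
    · simp only [hρ]
    · intro k hk
      by_contra hcon
      apply hk
      simp only
      rw [hρ0 k hcon, Real.zero_rpow hd0.ne']
      simp
  calc hausdorffContentVar d (fun z => ENNReal.ofReal (p z)) (E ∩ S)
      ≤ ∑' z : T, ENNReal.ofReal (C * r z ^ d) := hle.trans hsum.le
    _ = ENNReal.ofReal C * ∑' z : T, ENNReal.ofReal (r z ^ d) := by
        rw [← ENNReal.tsum_mul_left]
        simp only [ENNReal.ofReal_mul hC0]
    _ ≤ ENNReal.ofReal C * (9 * ∫⁻ z in Ss, G z ∂μ) := by gcongr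
    _ = ENNReal.ofReal (9 * C) * ∫⁻ z in Ss, G z ∂μ := by
        rw [ENNReal.ofReal_mul (by norm_num), ENNReal.ofReal_ofNat]; ring
    _ ≤ 60 * ∫⁻ z in Ss, G z ∂μ := by
        gcongr
        calc ENNReal.ofReal (9 * C) ≤ ENNReal.ofReal 60 := ENNReal.ofReal_le_ofReal hC
          _ = 60 := ENNReal.ofReal_ofNat 60
end
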